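/- arXiv:2101.08004 — 4 statements merged into one kernel-verified Lean document; each statement's English description precedes it below -/
import Mathlib

section
/- For every n ≥ 45, the maximum number of copies of K_4 in a B_{4,1}-free graph on n vertices equals ⌊(n-2)²/4⌋, where B_{4,1} is the graph consisting of two copies of K_4 sharing exactly one vertex. -/
open SimpleGraph

/-- The number of copies of `K_r` in `G`: the number of `r`-element vertex
subsets inducing a complete graph. -/
noncomputable def cliqueCount {V : Type*} (G : SimpleGraph V) (r : ℕ) : ℕ :=
  Set.ncard {S : Finset V | G.IsNClique r S}

/-- `G` is `B_{r,s}`-free: no two copies of `K_r` in `G` share exactly `s` vertices. -/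
def BFree {V : Type*} [DecidableEq V] (G : SimpleGraph V) (r s : ℕ) : Prop :=
  ∀ S T : Finset V, G.IsNClique r S → G.IsNClique r T → (S ∩ T).card ≠ s

section
variable {V : Type*} [DecidableEq V]

theorem two_le_inter {F : Finset (Finset V)} (h1 : ∀ A ∈ F, ∀ B ∈ F, (A ∩ B).card ≠ 1)
    {A B : Finset V} (hA : A ∈ F) (hB : B ∈ F) {x : V} (hxA : x ∈ A) (hxB : x ∈ B) :
    2 ≤ (A ∩ B).card := by
  have : 0 < (A ∩ B).card := Finset.card_pos.2 ⟨x, by simp [hxA, hxB]⟩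
  have := h1 A hA B hB
  omega

theorem exists_ne_mem_inter {F : Finset (Finset V)}
    (h1 : ∀ A ∈ F, ∀ B ∈ F, (A ∩ B).card ≠ 1)
    {A B : Finset V} (hA : A ∈ F) (hB : B ∈ F) {x : V} (hxA : x ∈ A) (hxB : x ∈ B) :
    ∃ y, y ≠ x ∧ y ∈ A ∧ y ∈ B := by
  obtain ⟨y, hy, hne⟩ := Finset.exists_mem_ne (two_le_inter h1 hA hB hxA hxB) x
  exact ⟨y, hne, (Finset.mem_inter.1 hy).1, (Finset.mem_inter.1 hy).2⟩

theorem card_filter_pair_le {F : Finset (Finset V)} (h4 : ∀ A ∈ F, A.card = 4)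
    (h1 : ∀ A ∈ F, ∀ B ∈ F, (A ∩ B).card ≠ 1)
    {d : ℕ} (hd : ∀ T : Finset V, T.card = 3 → (F.filter (T ⊆ ·)).card ≤ d)
    {u v : V} {B : Finset V} (hB : B ∈ F) (hu : u ∈ B) (hv : v ∉ B) :
    (F.filter fun A => u ∈ A ∧ v ∈ A).card ≤ 3 * d := by
  have hsub : (F.filter fun A => u ∈ A ∧ v ∈ A) ⊆
      (B.erase u).biUnion fun b => F.filter (({u, v, b} : Finset V) ⊆ ·) := by
    intro A hA
    simp only [Finset.mem_filter] at hA
    obtain ⟨y, hy, hyA, hyB⟩ := exists_ne_mem_inter h1 hA.1 hB hA.2.1 hu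
    simp only [Finset.mem_biUnion, Finset.mem_filter, Finset.mem_erase]
    refine ⟨y, ⟨hy, hyB⟩, hA.1, ?_⟩
    simp [Finset.insert_subset_iff, hA.2.1, hA.2.2, hyA]
  refine (Finset.card_le_card hsub).trans ?_
  have h3 : (B.erase u).card = 3 := by rw [Finset.card_erase_of_mem hu, h4 B hB]
  rw [← h3]
  refine Finset.card_biUnion_le_card_mul _ _ _ fun b hb => hd _ ?_
  simp only [Finset.mem_erase] at hb
  have : v ≠ b := fun h => hv (h ▸ hb.2)
  have : u ≠ v := fun h => hv (h ▸ hu)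
  exact Finset.card_eq_three.2 ⟨u, v, b, by tauto, fun h => hb.1 h.symm, by tauto, rfl⟩

/-- A `4`-uniform family without singleton intersections in which triples have degree at
most `d` and every two points are separated by a member has at most `9 d n / 4` members. -/
theorem card_le_of_separated {F : Finset (Finset V)} {S : Finset V}
    (hS : ∀ A ∈ F, A ⊆ S) (h4 : ∀ A ∈ F, A.card = 4)
    (h1 : ∀ A ∈ F, ∀ B ∈ F, (A ∩ B).card ≠ 1)
    {d : ℕ} (hd : ∀ T : Finset V, T.card = 3 → (F.filter (T ⊆ ·)).card ≤ d)
    (hsep : ∀ u ∈ S, ∀ v ∈ S, u ≠ v → ∃ B ∈ F, ¬(u ∈ B ↔ v ∈ B)) :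
    4 * F.card ≤ 9 * d * S.card := by
  have hpair : ∀ u ∈ S, ∀ v ∈ S, u ≠ v →
      (F.filter fun A => u ∈ A ∧ v ∈ A).card ≤ 3 * d := by
    intro u hu v hv huv
    obtain ⟨B, hB, hne⟩ := hsep u hu v hv huv
    by_cases huB : u ∈ B
    · exact card_filter_pair_le h4 h1 hd hB huB (by tauto)
    · have := card_filter_pair_le h4 h1 hd hB (u := v) (v := u) (by tauto) huB
      simpa only [and_comm] using this
  have hdeg : ∀ v ∈ S, (F.filter (v ∈ ·)).card ≤ 9 * d := by
    intro v hv
    rcases (F.filter (v ∈ ·)).eq_empty_or_nonempty with h | ⟨B, hB⟩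
    · simp [h]
    obtain ⟨hB, hvB⟩ := Finset.mem_filter.1 hB
    have hsub : F.filter (v ∈ ·) ⊆
        (B.erase v).biUnion fun b => F.filter fun A => v ∈ A ∧ b ∈ A := by
      intro A hA
      simp only [Finset.mem_filter] at hA
      obtain ⟨y, hy, hyA, hyB⟩ := exists_ne_mem_inter h1 hA.1 hB hA.2 hvB
      simp only [Finset.mem_biUnion, Finset.mem_filter, Finset.mem_erase]
      exact ⟨y, ⟨hy, hyB⟩, hA.1, hA.2, hyA⟩
    refine (Finset.card_le_card hsub).trans ?_
    have h3 : (B.erase v).card = 3 := by rw [Finset.card_erase_of_mem hvB, h4 B hB]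
    have : 9 * d = (B.erase v).card * (3 * d) := by rw [h3]; ring
    rw [this]
    refine Finset.card_biUnion_le_card_mul _ _ _ fun b hb => ?_
    simp only [Finset.mem_erase] at hb
    exact hpair v hv b (hS B hB hb.2) (Ne.symm hb.1)
  have hcount : ∑ v ∈ S, (F.filter (v ∈ ·)).card = ∑ A ∈ F, A.card := by
    have := Finset.sum_card_bipartiteAbove_eq_sum_card_bipartiteBelow
      (s := S) (t := F) (fun v A => v ∈ A)
    simp only [Finset.bipartiteAbove, Finset.bipartiteBelow] at this
    rw [this]
    refine Finset.sum_congr rfl fun A hA => ?_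
    rw [Finset.filter_mem_eq_inter, Finset.inter_eq_right.2 (hS A hA)]
  rw [Finset.sum_congr rfl h4, Finset.sum_const, smul_eq_mul] at hcount
  have := Finset.sum_le_card_nsmul S _ _ hdeg
  rw [hcount, smul_eq_mul] at this
  linarith

theorem two_le_card_inter_of_petals {F : Finset (Finset V)} (h4 : ∀ A ∈ F, A.card = 4)
    (h1 : ∀ A ∈ F, ∀ B ∈ F, (A ∩ B).card ≠ 1)
    {T W : Finset V} (hWF : ∀ w ∈ W, insert w T ∈ F)
    (hW : 5 ≤ W.card) {B : Finset V} (hB : B ∈ F) (hBT : (B ∩ T).Nonempty) :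
    2 ≤ (B ∩ T).card := by
  by_contra hlt
  obtain ⟨t, ht⟩ := hBT
  obtain ⟨htB, htT⟩ := Finset.mem_inter.1 ht
  have hWB : W ⊆ B := by
    intro w hw
    by_contra hwB
    have := two_le_inter h1 hB (hWF w hw) htB (Finset.mem_insert_of_mem htT)
    rw [Finset.inter_insert_of_notMem hwB] at this
    exact hlt this
  have := Finset.card_le_card hWB
  have := h4 B hB
  omega

/-- If a triple lies in at least five members of the family, then some two of its points are
not separated by the family, or some point has degree at most seven. -/
theorem exists_twin_or_card_le_seven {F : Finset (Finset V)} (h4 : ∀ A ∈ F, A.card = 4)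
    (h1 : ∀ A ∈ F, ∀ B ∈ F, (A ∩ B).card ≠ 1)
    {T W : Finset V} (hT : T.card = 3) (hWT : ∀ w ∈ W, w ∉ T)
    (hWF : ∀ w ∈ W, insert w T ∈ F) (hW : 5 ≤ W.card) :
    (∃ u ∈ T, ∃ v ∈ T, u ≠ v ∧ ∀ B ∈ F, u ∈ B ↔ v ∈ B) ∨
      ∃ w ∈ W, (F.filter (w ∈ ·)).card ≤ 7 := by
  have htwo : ∀ B ∈ F, ∀ t ∈ T, t ∈ B → 2 ≤ (B ∩ T).card := fun B hB t ht htB =>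
    two_le_card_inter_of_petals h4 h1 hWF hW hB ⟨t, Finset.mem_inter.2 ⟨htB, ht⟩⟩
  have hmiss : ∀ B ∈ F, ∀ s ∈ T, ∀ t ∈ T, s ∉ B → t ≠ s → ∀ r ∈ T, r ∈ B → t ∈ B := by
    intro B hB s hs t ht hsB hts r hr hrB
    by_contra htB
    have hle : B ∩ T ⊆ (T.erase s).erase t := by
      intro a ha
      simp only [Finset.mem_inter] at ha
      simp only [Finset.mem_erase]
      refine ⟨fun h => htB (h ▸ ha.1), fun h => hsB (h ▸ ha.1), ha.2⟩
    have := Finset.card_le_card hle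
    rw [Finset.card_erase_of_mem (by simp [hts, ht]), Finset.card_erase_of_mem hs, hT] at this
    have := htwo B hB r hr hrB
    omega
  by_cases hXY : ∃ X ∈ F, ∃ Y ∈ F, ∃ x ∈ T, ∃ y ∈ T, x ≠ y ∧ x ∉ X ∧ y ∉ Y ∧
      (∃ r ∈ T, r ∈ X) ∧ ∃ r ∈ T, r ∈ Y
  · right
    obtain ⟨X, hX, Y, hY, x, hx, y, hy, hxy, hxX, hyY, ⟨r, hr, hrX⟩, r', hr', hrY⟩ := hXY
    have hcard : ∀ Z ∈ F, ∀ r ∈ T, r ∈ Z → (Z \ T).card ≤ 2 := by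
      intro Z hZ r hr hrZ
      have := htwo Z hZ r hr hrZ
      have := Finset.card_sdiff_add_card_inter Z T
      have := h4 Z hZ
      omega
    obtain ⟨w, hw, hwn⟩ : ∃ w ∈ W, w ∉ (X \ T) ∪ (Y \ T) := by
      apply Finset.exists_mem_notMem_of_card_lt_card
      have := Finset.card_union_le (X \ T) (Y \ T)
      have := hcard X hX r hr hrX
      have := hcard Y hY r' hr' hrY
      omega
    refine ⟨w, hw, ?_⟩
    have hwT := hWT w hw
    have hwX : w ∉ X := fun h => hwn (by simp [h, hwT])
    have hwY : w ∉ Y := fun h => hwn (by simp [h, hwT])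
    have key : ∀ t ∈ T, ∃ Z ∈ F, w ∉ Z ∧ ∃ z ∈ T, z ≠ t ∧ z ∉ Z ∧ ∃ r ∈ T, r ∈ Z := by
      intro t ht
      by_cases h : x = t
      · exact ⟨Y, hY, hwY, y, hy, fun h' => hxy (h.trans h'.symm), hyY, r', hr', hrY⟩
      · exact ⟨X, hX, hwX, x, hx, h, hxX, r, hr, hrX⟩
    choose! Z hZF hwZ z hzT hzt hzZ r hrT hrZ using key
    have hsub : F.filter (w ∈ ·) ⊆ insert (insert w T)
        (T.biUnion fun t => (Z t \ T).image fun a => insert w (insert a (T.erase t))) := by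
      intro B hB
      obtain ⟨hB, hwB⟩ := Finset.mem_filter.1 hB
      simp only [Finset.mem_insert, Finset.mem_biUnion, Finset.mem_image]
      by_cases hTB : T ⊆ B
      · left
        refine (Finset.eq_of_subset_of_card_le (Finset.insert_subset hwB hTB) ?_).symm
        rw [Finset.card_insert_of_notMem hwT, hT, h4 B hB]
      right
      obtain ⟨t, ht, htB⟩ := Finset.not_subset.1 hTB
      obtain ⟨q, hqw, hqB, hqT⟩ := exists_ne_mem_inter h1 hB (hWF w hw) hwB (by simp)
      have hqT : q ∈ T := by simpa [hqw] using hqT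
      have hsubB : T.erase t ⊆ B := by
        intro a ha
        simp only [Finset.mem_erase] at ha
        exact hmiss B hB t ht a ha.2 htB ha.1 q hqT hqB
      -- the third point of `T` lies in both `B` and `Z t`
      obtain ⟨c, hc⟩ : ∃ c, c ∈ (T.erase t).erase (z t) := by
        apply Finset.card_pos.1
        rw [Finset.card_erase_of_mem (by simp [hzt t ht, hzT t ht]),
          Finset.card_erase_of_mem ht, hT]
        norm_num
      simp only [Finset.mem_erase] at hc
      have hcB : c ∈ B := hsubB (by simp [hc])
      have hcZ : c ∈ Z t :=
        hmiss (Z t) (hZF t ht) (z t) (hzT t ht) c hc.2.2 (hzZ t ht) hc.1 _ (hrT t ht) (hrZ t ht)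
      obtain ⟨a, hac, haB, haZ⟩ := exists_ne_mem_inter h1 hB (hZF t ht) hcB hcZ
      have haT : a ∉ T := by
        intro haT
        have hat : a ≠ t := fun h => htB (h ▸ haB)
        have haz : a ≠ z t := fun h => hzZ t ht (h ▸ haZ)
        have h3 : ({t, z t, a, c} : Finset V) ⊆ T := by
          simp [Finset.insert_subset_iff, ht, hzT t ht, haT, hc.2.2]
        have := Finset.card_le_card h3
        rw [Finset.card_insert_of_notMem, Finset.card_insert_of_notMem,
          Finset.card_insert_of_notMem, Finset.card_singleton] at this
        · omega
        · simpa using hac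
        · simp only [Finset.mem_insert, Finset.mem_singleton, not_or]
          exact ⟨haz.symm, fun h => hc.1 h.symm⟩
        · simp only [Finset.mem_insert, Finset.mem_singleton, not_or]
          exact ⟨(hzt t ht).symm, hat.symm, fun h => hc.2.1 h.symm⟩
      refine ⟨t, ht, a, by simp [haZ, haT], ?_⟩
      refine Finset.eq_of_subset_of_card_le ?_ ?_
      · exact Finset.insert_subset hwB (Finset.insert_subset haB hsubB)
      · rw [Finset.card_insert_of_notMem, Finset.card_insert_of_notMem,
          Finset.card_erase_of_mem ht, hT, h4 B hB]
        · simp [haT]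
        · have : w ≠ a := fun h => hwZ t ht (h ▸ haZ)
          simp [this, hwT]
    refine (Finset.card_le_card hsub).trans ((Finset.card_insert_le _ _).trans ?_)
    have : (T.biUnion fun t =>
        (Z t \ T).image fun a => insert w (insert a (T.erase t))).card ≤ T.card * 2 :=
      Finset.card_biUnion_le_card_mul _ _ _ fun t ht =>
        Finset.card_image_le.trans (hcard _ (hZF t ht) _ (hrT t ht) (hrZ t ht))
    omega
  · left
    obtain ⟨a, b, c, hab, hac, hbc, rfl⟩ := Finset.card_eq_three.1 hT
    obtain ⟨t, ht, hall⟩ : ∃ t ∈ ({a, b, c} : Finset V), ∀ B ∈ F, ∀ r ∈ ({a, b, c} : Finset V),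
        r ∈ B → ∀ s ∈ ({a, b, c} : Finset V), s ≠ t → s ∈ B := by
      by_contra! hcon
      obtain ⟨X, hX, r, hr, hrX, s, hs, hst, hsX⟩ := hcon a (by simp)
      obtain ⟨Y, hY, r', hr', hrY, s', hs', hst', hsY⟩ := hcon s hs
      exact hXY ⟨X, hX, Y, hY, s, hs, s', hs', hst'.symm, hsX, hsY, ⟨r, hr, hrX⟩, r', hr', hrY⟩
    obtain ⟨u, hu, v, hv, huv, hut, hvt⟩ : ∃ u ∈ ({a, b, c} : Finset V),
        ∃ v ∈ ({a, b, c} : Finset V), u ≠ v ∧ u ≠ t ∧ v ≠ t := by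
      have : 1 < (({a, b, c} : Finset V).erase t).card := by
        rw [Finset.card_erase_of_mem ht, hT]; norm_num
      obtain ⟨u, hu, v, hv, huv⟩ := Finset.one_lt_card.1 this
      simp only [Finset.mem_erase] at hu hv
      exact ⟨u, hu.2, v, hv.2, huv, hu.1, hv.1⟩
    exact ⟨u, hu, v, hv, huv, fun B hB =>
      ⟨fun h => hall B hB u hu h v hv hvt, fun h => hall B hB v hv h u hu hut⟩⟩
end

theorem max_pred_add_seven_le_max {s : ℕ} (hs : 0 < s) :
    max (9 * (s - 1)) ((s - 1 - 2) ^ 2 / 4) + 7 ≤ max (9 * s) ((s - 2) ^ 2 / 4) := by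
  rcases le_or_gt s 20 with h | h
  · interval_cases s <;> norm_num
  obtain ⟨k, rfl⟩ := Nat.exists_eq_add_of_lt h
  have h1 : 20 + k + 1 - 1 - 2 = 18 + k := by omega
  have h2 : 20 + k + 1 - 2 = 19 + k := by omega
  have h3 : (19 + k) ^ 2 = (18 + k) ^ 2 + 2 * k + 37 := by ring
  rw [h1, h2, h3]
  generalize (18 + k) ^ 2 = a
  omega

theorem sq_div_four_add_max_le_max (p q : ℕ) :
    p ^ 2 / 4 + q / 2 + max (9 * q) ((q - 2) ^ 2 / 4) ≤
      max (9 * (p + q + 2)) ((p + q + 2 - 2) ^ 2 / 4) := by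
  rcases Nat.eq_zero_or_pos q with rfl | hpos
  · simp
  rw [show p + q + 2 - 2 = p + q by omega, show (p + q) ^ 2 = p ^ 2 + q ^ 2 + 2 * (p * q) by ring]
  rcases le_total ((q - 2) ^ 2 / 4) (9 * q) with h | h
  · rw [max_eq_left h]
    rcases le_or_gt 38 (p + q) with hpq | hpq
    · have : 38 * q ≤ q ^ 2 + 2 * (p * q) := by nlinarith [Nat.zero_le (p * q)]
      generalize p ^ 2 = a at *
      generalize q ^ 2 = b at *
      generalize p * q = c at *
      omega
    · have : p ^ 2 ≤ 37 * p := by nlinarith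
      have : p ^ 2 / 4 + q / 2 ≤ 9 * (p + 2) := by
        generalize p ^ 2 = a at *
        omega
      omega
  · rw [max_eq_right h]
    have hq : 2 ≤ q := by
      by_contra hq
      have : q - 2 = 0 := by omega
      rw [this] at h
      omega
    obtain ⟨k, rfl⟩ := Nat.exists_eq_add_of_le hq
    rw [show 2 + k - 2 = k by omega, show (2 + k) ^ 2 = k ^ 2 + 4 * k + 4 by ring]
    generalize p ^ 2 = a at *
    generalize k ^ 2 = b at *
    generalize p * (2 + k) = c at *
    omega

section
variable {V : Type*} [DecidableEq V]

/-- Mantel's theorem for a family of two-element sets. -/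
theorem card_le_of_triangle_free {E : Finset (Finset V)} {P : Finset V}
    (hP : ∀ e ∈ E, e ⊆ P) (h2 : ∀ e ∈ E, e.card = 2)
    (htri : ∀ x y z, ({x, y} : Finset V) ∈ E → ({y, z} : Finset V) ∈ E →
      ({x, z} : Finset V) ∉ E) :
    E.card ≤ P.card ^ 2 / 4 := by
  classical
  let H : SimpleGraph P :=
    { Adj := fun x y => ({x.1, y.1} : Finset V) ∈ E
      symm := ⟨fun x y h => by rwa [Finset.pair_comm]⟩
      loopless := ⟨fun x h => by simpa using h2 _ h⟩ }
  have hfree : H.CliqueFree 3 := by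
    intro s hs
    obtain ⟨x, y, z, hxy, hxz, hyz, -⟩ := is3Clique_iff.1 hs
    exact htri _ _ _ hxy hyz hxz
  have hsub : E ⊆ H.edgeFinset.image fun e => e.toFinset.map (Function.Embedding.subtype _) := by
    intro e he
    obtain ⟨x, y, -, rfl⟩ := Finset.card_eq_two.1 (h2 e he)
    have hx : x ∈ P := hP _ he (by simp)
    have hy : y ∈ P := hP _ he (by simp)
    refine Finset.mem_image.2 ⟨s(⟨x, hx⟩, ⟨y, hy⟩), ?_, ?_⟩
    · rw [mem_edgeFinset, mem_edgeSet]
      exact he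
    · simp [Sym2.toFinset_mk_eq]
  have hle := (Finset.card_le_card hsub).trans Finset.card_image_le
  have hT := hfree.card_edgeFinset_le
  simp only [Fintype.card_coe] at hT
  refine hle.trans (hT.trans ?_)
  rcases Nat.mod_two_eq_zero_or_one P.card with h | h <;> rw [h] <;> simp
  exact Nat.div_le_div_right (Nat.sub_le _ _)

open Classical in
/-- The copies of `K_4` of `G` lying inside `S`. -/
noncomputable def fourCliques (G : SimpleGraph V) (S : Finset V) : Finset (Finset V) :=
  S.powerset.filter (G.IsNClique 4)

theorem mem_fourCliques {G : SimpleGraph V} {S A : Finset V} :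
    A ∈ fourCliques G S ↔ A ⊆ S ∧ G.IsNClique 4 A := by
  simp [fourCliques]

/-- If `u` and `v` are not separated by the copies of `K_4` inside `S`, then their common link is
a triangle-free graph together with some isolated edges. -/
theorem exists_card_fourCliques_le_of_twin {G : SimpleGraph V} (hG : BFree G 4 1)
    {S : Finset V} {u v : V} (hu : u ∈ S) (hv : v ∈ S) (huv : u ≠ v)
    (htwin : ∀ B ∈ fourCliques G S, u ∈ B ↔ v ∈ B) :
    ∃ (Q : Finset V) (p : ℕ), p + Q.card + 2 = S.card ∧
      (fourCliques G S).card ≤ p ^ 2 / 4 + Q.card / 2 + (fourCliques G Q).card := by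
  classical
  set R := S \ {u, v} with hR
  have huR : u ∉ R := by simp [hR]
  have hvR : v ∉ R := by simp [hR]
  have hRc : R.card + 2 = S.card := by
    have := Finset.card_sdiff_add_card_eq_card (s := {u, v}) (t := S)
      (by simp [Finset.insert_subset_iff, hu, hv])
    rwa [Finset.card_pair huv] at this
  set Q := (fourCliques G R).biUnion id with hQ
  have hQR : Q ⊆ R := by
    intro x hx
    simp only [hQ, Finset.mem_biUnion, id] at hx
    obtain ⟨A, hA, hxA⟩ := hx
    exact (mem_fourCliques.1 hA).1 hxA
  set E := ((fourCliques G S).filter (u ∈ ·)).image (· \ {u, v}) with hEdef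
  have hins : ∀ {e : Finset V}, e ∈ E → e ⊆ R ∧ e.card = 2 ∧ G.IsNClique 4 (insert u (insert v e)) := by
    intro e he
    simp only [hEdef, Finset.mem_image, Finset.mem_filter] at he
    obtain ⟨A, ⟨hA, huA⟩, rfl⟩ := he
    have hvA := (htwin A hA).1 huA
    obtain ⟨hAS, hAc⟩ := mem_fourCliques.1 hA
    have hs : ({u, v} : Finset V) ⊆ A := by simp [Finset.insert_subset_iff, huA, hvA]
    have h := Finset.card_sdiff_add_card_eq_card hs
    rw [Finset.card_pair huv, hAc.card_eq] at h
    refine ⟨Finset.sdiff_subset_sdiff hAS subset_rfl, by omega, ?_⟩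
    have : insert u (insert v (A \ {u, v})) = A := by
      have := Finset.union_sdiff_of_subset hs
      rwa [Finset.insert_union, Finset.singleton_union] at this
    rwa [this]
  have hadj : ∀ {x y : V}, ({x, y} : Finset V) ∈ E →
      x ∈ R ∧ y ∈ R ∧ G.Adj u x ∧ G.Adj u y ∧ G.Adj x y := by
    intro x y he
    obtain ⟨hsub, hc, hcl⟩ := hins he
    have hx : x ∈ R := hsub (by simp)
    have hy : y ∈ R := hsub (by simp)
    have hxy : x ≠ y := by rintro rfl; simp at hc
    have hadj := hcl.isClique
    refine ⟨hx, hy, hadj (by simp) (by simp) ?_, hadj (by simp) (by simp) ?_,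
      hadj (by simp) (by simp) hxy⟩
    · exact fun h => huR (h ▸ hx)
    · exact fun h => huR (h ▸ hy)
  have hno : ∀ {x y z : V}, ({x, y} : Finset V) ∈ E → ({x, z} : Finset V) ∈ E → ¬ G.Adj y z := by
    intro x y z hxy hxz hyz
    obtain ⟨hx, hy, hux, huy, hxy⟩ := hadj hxy
    obtain ⟨-, hz, -, huz, hxz⟩ := hadj hxz
    have hcl : G.IsNClique 4 {u, x, y, z} := by
      have h3 : G.IsNClique 3 {x, y, z} := is3Clique_triple_iff.2 ⟨hxy, hxz, hyz⟩
      refine h3.insert ?_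
      simp [hux, huy, huz]
    have hmem : ({u, x, y, z} : Finset V) ∈ fourCliques G S := by
      refine mem_fourCliques.2 ⟨?_, hcl⟩
      have hRS : R ⊆ S := Finset.sdiff_subset
      simp [Finset.insert_subset_iff, hu, hRS hx, hRS hy, hRS hz]
    have := (htwin _ hmem).1 (by simp)
    simp only [Finset.mem_insert, Finset.mem_singleton] at this
    rcases this with h | h | h | h
    · exact huv h.symm
    · exact hvR (h ▸ hx)
    · exact hvR (h ▸ hy)
    · exact hvR (h ▸ hz)
  have hEtri : ∀ x y z, ({x, y} : Finset V) ∈ E → ({y, z} : Finset V) ∈ E →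
      ({x, z} : Finset V) ∉ E := by
    intro x y z hxy hyz hxz
    exact hno hxy hxz (hadj hyz).2.2.2.2
  -- a clique avoiding `u` and `v` contains every link edge that it meets
  have hclosed : ∀ {C : Finset V}, C ∈ fourCliques G R → ∀ {x y : V}, ({x, y} : Finset V) ∈ E →
      x ∈ C → y ∈ C := by
    intro C hC x y hxy hx
    obtain ⟨hCR, hCc⟩ := mem_fourCliques.1 hC
    obtain ⟨-, -, hcl⟩ := hins hxy
    by_contra hy
    apply hG _ _ hcl hCc
    rw [Finset.card_eq_one]
    refine ⟨x, ?_⟩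
    ext a
    simp only [Finset.mem_inter, Finset.mem_insert, Finset.mem_singleton]
    constructor
    · rintro ⟨rfl | rfl | rfl | rfl, ha⟩
      · exact absurd (hCR ha) huR
      · exact absurd (hCR ha) hvR
      · rfl
      · exact absurd ha hy
    · rintro rfl
      exact ⟨by simp, hx⟩
  have hpair : ∀ {e : Finset V}, e ∈ E → ∀ {x : V}, x ∈ e → ∃ y, e = {x, y} := by
    intro e he x hx
    obtain ⟨a, b, -, rfl⟩ := Finset.card_eq_two.1 (hins he).2.1
    simp only [Finset.mem_insert, Finset.mem_singleton] at hx
    rcases hx with rfl | rfl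
    · exact ⟨b, rfl⟩
    · exact ⟨a, Finset.pair_comm _ _⟩
  have hdich : ∀ e ∈ E, ¬ e ⊆ R \ Q → e ⊆ Q := by
    intro e he hne
    obtain ⟨x, hxe, hx⟩ := Finset.not_subset.1 hne
    have hxQ : x ∈ Q := by
      by_contra h
      exact hx (Finset.mem_sdiff.2 ⟨(hins he).1 hxe, h⟩)
    obtain ⟨y, rfl⟩ := hpair he hxe
    have hxQ' := hxQ
    simp only [hQ, Finset.mem_biUnion, id] at hxQ'
    obtain ⟨C, hC, hxC⟩ := hxQ'
    have hyQ : y ∈ Q := Finset.mem_biUnion.2 ⟨C, hC, hclosed hC he hxC⟩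
    simp [Finset.insert_subset_iff, hxQ, hyQ]
  have hE1 : (E.filter (· ⊆ R \ Q)).card ≤ (R \ Q).card ^ 2 / 4 := by
    refine card_le_of_triangle_free (fun e he => (Finset.mem_filter.1 he).2)
      (fun e he => (hins (Finset.mem_filter.1 he).1).2.1) fun x y z h h' h'' =>
      hEtri x y z (Finset.mem_filter.1 h).1 (Finset.mem_filter.1 h').1 (Finset.mem_filter.1 h'').1
  have hE2 : (E.filter fun e => ¬ e ⊆ R \ Q).card ≤ Q.card / 2 := by
    have hdisj : ((E.filter fun e => ¬ e ⊆ R \ Q : Finset (Finset V)) : Set (Finset V)).PairwiseDisjoint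
        id := by
      intro e he f hf hef
      simp only [Finset.coe_filter, Set.mem_ofPred_eq] at he hf
      rw [Function.onFun, Finset.disjoint_left]
      intro x hxe hxf
      have hxQ : x ∈ Q := hdich e he.1 he.2 hxe
      obtain ⟨y, rfl⟩ := hpair he.1 hxe
      obtain ⟨z, rfl⟩ := hpair hf.1 hxf
      simp only [hQ, Finset.mem_biUnion, id] at hxQ
      obtain ⟨C, hC, hxC⟩ := hxQ
      have hyC := hclosed hC he.1 hxC
      have hzC := hclosed hC hf.1 hxC
      exact hno he.1 hf.1 ((mem_fourCliques.1 hC).2.isClique hyC hzC (by rintro rfl; exact hef rfl))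
    have hcard := Finset.card_biUnion hdisj
    simp only [id] at hcard
    rw [Finset.sum_congr rfl fun e he => (hins (Finset.mem_filter.1 he).1).2.1,
      Finset.sum_const, smul_eq_mul] at hcard
    have : ((E.filter fun e => ¬ e ⊆ R \ Q).biUnion id).card ≤ Q.card := by
      refine Finset.card_le_card fun x hx => ?_
      simp only [Finset.mem_biUnion, Finset.mem_filter, id] at hx
      obtain ⟨e, he, hx⟩ := hx
      exact hdich e he.1 he.2 hx
    omega
  have hEc : ((fourCliques G S).filter (u ∈ ·)).card = E.card := by
    refine (Finset.card_image_of_injOn ?_).symm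
    intro A hA B hB hAB
    simp only [Finset.coe_filter, Set.mem_ofPred_eq] at hA hB
    have hs : ∀ C ∈ fourCliques G S, u ∈ C → ({u, v} : Finset V) ⊆ C := by
      intro C hC huC
      simp [Finset.insert_subset_iff, huC, (htwin C hC).1 huC]
    rw [← Finset.union_sdiff_of_subset (hs A hA.1 hA.2),
      ← Finset.union_sdiff_of_subset (hs B hB.1 hB.2)]
    exact congrArg _ hAB
  have hrest : ((fourCliques G S).filter (u ∉ ·)) ⊆ fourCliques G Q := by
    intro A hA
    obtain ⟨hA, huA⟩ := Finset.mem_filter.1 hA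
    obtain ⟨hAS, hAc⟩ := mem_fourCliques.1 hA
    have hvA : v ∉ A := fun h => huA ((htwin A hA).2 h)
    have hAR : A ∈ fourCliques G R := by
      refine mem_fourCliques.2 ⟨fun x hx => ?_, hAc⟩
      simp only [hR, Finset.mem_sdiff, Finset.mem_insert, Finset.mem_singleton, not_or]
      exact ⟨hAS hx, fun h => huA (h ▸ hx), fun h => hvA (h ▸ hx)⟩
    exact mem_fourCliques.2 ⟨Finset.subset_biUnion_of_mem id hAR, hAc⟩
  refine ⟨Q, (R \ Q).card, ?_, ?_⟩
  · have := Finset.card_sdiff_add_card_eq_card hQR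
    omega
  · rw [← Finset.card_filter_add_card_filter_not (s := fourCliques G S) (u ∈ ·), hEc,
      ← Finset.card_filter_add_card_filter_not (s := E) (· ⊆ R \ Q)]
    have := Finset.card_le_card hrest
    omega

/-- The main upper bound, valid for every number of vertices. -/
theorem card_fourCliques_le {G : SimpleGraph V} (hG : BFree G 4 1) (S : Finset V) :
    (fourCliques G S).card ≤ max (9 * S.card) ((S.card - 2) ^ 2 / 4) := by
  classical
  induction hs : S.card using Nat.strong_induction_on generalizing S with
  | _ s ih =>
  subst hs
  have h4 : ∀ A ∈ fourCliques G S, A.card = 4 := fun A hA => (mem_fourCliques.1 hA).2.card_eq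
  have h1 : ∀ A ∈ fourCliques G S, ∀ B ∈ fourCliques G S, (A ∩ B).card ≠ 1 :=
    fun A hA B hB => hG A B (mem_fourCliques.1 hA).2 (mem_fourCliques.1 hB).2
  have hS : ∀ A ∈ fourCliques G S, A ⊆ S := fun A hA => (mem_fourCliques.1 hA).1
  by_cases hlow : ∃ w ∈ S, ((fourCliques G S).filter (w ∈ ·)).card ≤ 7
  · obtain ⟨w, hw, hwc⟩ := hlow
    have hsub : (fourCliques G S).filter (w ∉ ·) ⊆ fourCliques G (S.erase w) := by
      intro A hA
      obtain ⟨hA, hwA⟩ := Finset.mem_filter.1 hA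
      obtain ⟨hAS, hAc⟩ := mem_fourCliques.1 hA
      exact mem_fourCliques.2 ⟨Finset.subset_erase.2 ⟨hAS, hwA⟩, hAc⟩
    have hle := Finset.card_le_card hsub
    have hpos := Finset.card_pos.2 ⟨w, hw⟩
    have hrec := ih _ (Finset.card_erase_lt_of_mem hw) _ rfl
    rw [Finset.card_erase_of_mem hw] at hrec
    have hsum := Finset.card_filter_add_card_filter_not (s := fourCliques G S) (w ∈ ·)
    have : max (9 * (S.card - 1)) ((S.card - 1 - 2) ^ 2 / 4) + 7 ≤
        max (9 * S.card) ((S.card - 2) ^ 2 / 4) := max_pred_add_seven_le_max hpos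
    omega
  by_cases htw : ∃ u ∈ S, ∃ v ∈ S, u ≠ v ∧ ∀ B ∈ fourCliques G S, u ∈ B ↔ v ∈ B
  · obtain ⟨u, hu, v, hv, huv, htwin⟩ := htw
    obtain ⟨Q, p, hpq, hle⟩ := exists_card_fourCliques_le_of_twin hG hu hv huv htwin
    have hrec := ih _ (by omega) Q rfl
    refine hle.trans ((Nat.add_le_add_left hrec _).trans ?_)
    rw [← hpq]
    exact sq_div_four_add_max_le_max p Q.card
  push Not at hlow htw
  have hd : ∀ T : Finset V, T.card = 3 → ((fourCliques G S).filter (T ⊆ ·)).card ≤ 4 := by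
    intro T hT
    by_contra! hlt
    set W := S.filter fun w => w ∉ T ∧ insert w T ∈ fourCliques G S with hW
    have hsub : (fourCliques G S).filter (T ⊆ ·) ⊆ W.image (insert · T) := by
      intro A hA
      obtain ⟨hA, hTA⟩ := Finset.mem_filter.1 hA
      obtain ⟨w, hw⟩ := Finset.card_eq_one.1 (show (A \ T).card = 1 by
        have := Finset.card_sdiff_add_card_eq_card hTA
        have := h4 A hA
        omega)
      have hwA : w ∈ A \ T := by simp [hw]
      have hAw : insert w T = A := by
        rw [← Finset.sdiff_union_of_subset hTA, hw, Finset.singleton_union]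
      simp only [Finset.mem_sdiff] at hwA
      exact Finset.mem_image.2 ⟨w, Finset.mem_filter.2 ⟨hS A hA hwA.1, hwA.2, hAw ▸ hA⟩, hAw⟩
    have hWc : 5 ≤ W.card := hlt.trans_le ((Finset.card_le_card hsub).trans Finset.card_image_le)
    obtain ⟨A, hA⟩ := Finset.card_pos.1 (lt_of_le_of_lt (Nat.zero_le _) hlt)
    obtain ⟨hA, hTA⟩ := Finset.mem_filter.1 hA
    rcases exists_twin_or_card_le_seven h4 h1 hT (W := W) (fun w hw => (Finset.mem_filter.1 hw).2.1)
      (fun w hw => (Finset.mem_filter.1 hw).2.2) hWc with ⟨u, hu, v, hv, huv, h⟩ | ⟨w, hw, h⟩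
    · obtain ⟨B, hB, h'⟩ := htw u (hS A hA (hTA hu)) v (hS A hA (hTA hv)) huv
      have := h B hB
      tauto
    · have := hlow w (Finset.mem_filter.1 hw).1
      omega
  have := card_le_of_separated hS h4 h1 hd fun u hu v hv huv => by
    obtain ⟨B, hB, h⟩ := htw u hu v hv huv
    exact ⟨B, hB, by tauto⟩
  exact le_max_of_le_left (by omega)
end

/-- The joinof an edge with a balanced complete bipartite graph, on `Fin n`. -/
def coneBipartite (n : ℕ) : SimpleGraph (Fin n) where
  Adj i j := i ≠ j ∧ (i.1 < 2 ∨ j.1 < 2 ∨ i.1 % 2 ≠ j.1 % 2)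
  symm := ⟨fun i j h => ⟨h.1.symm, by have := h.2; omega⟩⟩
  loopless := ⟨fun i h => h.1 rfl⟩

theorem mem_of_isNClique_coneBipartite {n : ℕ} {A : Finset (Fin n)}
    (hA : (coneBipartite n).IsNClique 4 A) {x : Fin n} (hx : x.1 < 2) : x ∈ A := by
  by_contra hxA
  have hhigh : (A.filter fun i => ¬ i.1 < 2).card ≤ 2 := by
    have h : (A.filter fun i => ¬ i.1 < 2).card ≤ (Finset.range 2).card := by
      refine Finset.card_le_card_of_injOn (fun i => i.1 % 2) ?_ ?_
      · intro i _
        simpa using Nat.mod_lt i.1 two_pos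
      · intro i hi j hj hij
        simp only [Finset.coe_filter, Set.mem_ofPred_eq] at hi hj
        by_contra hne
        have := (hA.isClique hi.1 hj.1 hne).2
        simp only at hij
        omega
    simpa using h
  have hlow : (A.filter fun i => i.1 < 2).card ≤ 1 := by
    refine Finset.card_le_one.2 fun a ha b hb => ?_
    simp only [Finset.mem_filter] at ha hb
    have h1 : a.1 ≠ x.1 := fun h => hxA (Fin.ext h ▸ ha.1)
    have h2 : b.1 ≠ x.1 := fun h => hxA (Fin.ext h ▸ hb.1)
    apply Fin.ext
    omega
  have := Finset.card_filter_add_card_filter_not (s := A) fun i => i.1 < 2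
  rw [hA.card_eq] at this
  omega

theorem bFree_coneBipartite {n : ℕ} (hn : 2 ≤ n) : BFree (coneBipartite n) 4 1 := by
  intro A B hA hB h
  have hlt : 1 < (A ∩ B).card := by
    refine Finset.one_lt_card.2 ⟨⟨0, by omega⟩, ?_, ⟨1, by omega⟩, ?_, by simp⟩ <;>
    · rw [Finset.mem_inter]
      exact ⟨mem_of_isNClique_coneBipartite hA (by simp),
        mem_of_isNClique_coneBipartite hB (by simp)⟩
  omega

theorem le_card_fourCliques_coneBipartite {n : ℕ} (hn : 2 ≤ n) :
    (n - 2) ^ 2 / 4 ≤ (fourCliques (coneBipartite n) Finset.univ).card := by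
  have hcard : (n - 2) ^ 2 / 4 = (Finset.univ : Finset (Fin ((n - 1) / 2) × Fin ((n - 2) / 2))).card := by
    simp only [Finset.card_univ, Fintype.card_prod, Fintype.card_fin]
    obtain ⟨k, rfl⟩ := Nat.exists_eq_add_of_le hn
    rw [show 2 + k - 2 = k by omega, show 2 + k - 1 = k + 1 by omega]
    rcases Nat.even_or_odd' k with ⟨m, rfl | rfl⟩
    · rw [show (2 * m + 1) / 2 = m by omega, show 2 * m / 2 = m by omega,
        show (2 * m) ^ 2 = 4 * (m * m) by ring]
      omega
    · rw [show (2 * m + 1 + 1) / 2 = m + 1 by omega, show (2 * m + 1) / 2 = m by omega,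
        show (2 * m + 1) ^ 2 = 4 * ((m + 1) * m) + 1 by ring]
      omega
  rw [hcard]
  refine Finset.card_le_card_of_injOn (fun ab => ({⟨0, by omega⟩, ⟨1, by omega⟩,
    ⟨2 + 2 * ab.1.1, by omega⟩, ⟨3 + 2 * ab.2.1, by omega⟩} : Finset (Fin n))) ?_ ?_
  · intro ⟨a, b⟩ _
    refine mem_fourCliques.2 ⟨Finset.subset_univ _, ?_⟩
    have h3 : (coneBipartite n).IsNClique 3 {⟨1, by omega⟩,
        ⟨2 + 2 * a.1, by omega⟩, ⟨3 + 2 * b.1, by omega⟩} := by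
      refine is3Clique_triple_iff.2 ⟨?_, ?_, ?_⟩ <;>
      · simp only [coneBipartite, ne_eq, Fin.mk.injEq]
        omega
    refine h3.insert fun x hx => ?_
    simp only [Finset.mem_insert, Finset.mem_singleton] at hx
    rcases hx with rfl | rfl | rfl <;>
    · simp only [coneBipartite, ne_eq, Fin.mk.injEq]
      omega
  · intro ⟨a, b⟩ _ ⟨a', b'⟩ _ h
    simp only at h
    have ha : (⟨2 + 2 * a.1, by omega⟩ : Fin n) ∈ ({⟨0, by omega⟩, ⟨1, by omega⟩,
        ⟨2 + 2 * a'.1, by omega⟩, ⟨3 + 2 * b'.1, by omega⟩} : Finset (Fin n)) := by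
      rw [← h]; simp
    have hb : (⟨3 + 2 * b.1, by omega⟩ : Fin n) ∈ ({⟨0, by omega⟩, ⟨1, by omega⟩,
        ⟨2 + 2 * a'.1, by omega⟩, ⟨3 + 2 * b'.1, by omega⟩} : Finset (Fin n)) := by
      rw [← h]; simp
    simp only [Finset.mem_insert, Finset.mem_singleton, Fin.mk.injEq] at ha hb
    ext <;> simp only <;> omega

/-- For `n ≥ 45`, the maximum number of copies of `K_4` in a `B_{4,1}`-free graph
on `n` vertices equals `⌊(n-2)²/4⌋`. -/
theorem stmt0 (n : ℕ) (hn : 45 ≤ n) :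
    IsGreatest {m | ∃ G : SimpleGraph (Fin n), BFree G 4 1 ∧ cliqueCount G 4 = m}
      ((n - 2) ^ 2 / 4) := by
  have hcount : ∀ G : SimpleGraph (Fin n), cliqueCount G 4 = (fourCliques G Finset.univ).card := by
    intro G
    rw [cliqueCount, ← Set.ncard_coe_finset]
    congr 1
    ext A
    simp [mem_fourCliques]
  have hupper : ∀ G : SimpleGraph (Fin n), BFree G 4 1 → cliqueCount G 4 ≤ (n - 2) ^ 2 / 4 := by
    intro G hG
    rw [hcount]
    have := card_fourCliques_le hG Finset.univ
    rw [Finset.card_univ, Fintype.card_fin] at this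
    refine this.trans (max_le ?_ le_rfl)
    obtain ⟨k, rfl⟩ := Nat.exists_eq_add_of_le hn
    rw [Nat.le_div_iff_mul_le (by norm_num), show 45 + k - 2 = 43 + k by omega]
    nlinarith
  refine ⟨⟨coneBipartite n, bFree_coneBipartite (by omega), ?_⟩, ?_⟩
  · refine le_antisymm (hupper _ (bFree_coneBipartite (by omega))) ?_
    rw [hcount]
    exact le_card_fourCliques_coneBipartite (by omega)
  · rintro m ⟨G, hG, rfl⟩
    exact hupper G hG
end

section
/- Let r ≤ 2s and let β_{r,s} be the maximum length of an s-sum-free partition of r. Then there exist positive constants c_1, c_2 such that c_1 n^{β_{r,s}} ≤ ex(n, K_r, B_{r,s}) ≤ c_2 n^s for all sufficiently large n, where r > s ≥ 2. -/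
open SimpleGraph

/-- `ex(n, K_r, B_{r,s})`: the maximum number of copies of `K_r` in a `B_{r,s}`-free
graph on `n` vertices. -/
noncomputable def exB (n r s : ℕ) : ℕ :=
  sSup {m | ∃ G : SimpleGraph (Fin n), BFree G r s ∧ cliqueCount G r = m}

/-- `a` is an `s`-sum-free partition of `r` of length `t`: weakly decreasing
positive entries summing to `r`, no subset of which sums to `s`. -/
def IsSSumFreePartition (r s t : ℕ) (a : Fin t → ℕ) : Prop :=
  Antitone a ∧ (∀ i, 0 < a i) ∧ (∑ i, a i = r) ∧
    ∀ I : Finset (Fin t), ∑ i ∈ I, a i ≠ s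

section SubsetSums

variable {ι : Type*} [Fintype ι] [DecidableEq ι]

lemma sum_mem_erase_eq_sum_notMem_insert (φ ψ : Finset ι → ℚ) :
    ∑ A, ∑ x ∈ A, φ A * ψ (A.erase x) = ∑ B, ∑ y ∈ Bᶜ, φ (insert y B) * ψ B := by
  rw [Finset.sum_sigma', Finset.sum_sigma']
  refine Finset.sum_nbij' (fun p => ⟨p.1.erase p.2, p.2⟩) (fun p => ⟨insert p.2 p.1, p.2⟩)
    ?_ ?_ ?_ ?_ ?_
  · rintro ⟨A, x⟩ h; simp
  · rintro ⟨A, x⟩ h; simp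
  · rintro ⟨A, x⟩ h
    simp only [Finset.mem_sigma, Finset.mem_univ, true_and] at h
    simp [Finset.insert_erase h]
  · rintro ⟨A, x⟩ h
    simp only [Finset.mem_sigma, Finset.mem_univ, true_and, Finset.mem_compl] at h
    simp [Finset.erase_insert h]
  · rintro ⟨A, x⟩ h
    simp only [Finset.mem_sigma, Finset.mem_univ, true_and] at h
    simp [Finset.insert_erase h]

/-- The inclusion matrix of `k`-sets against `(k + 1)`-sets is injective below the middle layer. -/
lemma eq_zero_of_sum_erase_eq_zero {k : ℕ} (hk : 2 * k < Fintype.card ι) (f : Finset ι → ℚ)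
    (hf : ∀ V : Finset ι, V.card = k + 1 → ∑ x ∈ V, f (V.erase x) = 0)
    (A : Finset ι) (hA : A.card = k) : f A = 0 := by
  set φ : Finset ι → ℚ := fun B => if B.card = k then f B else 0 with hφ
  set ψ : Finset ι → ℚ := fun B => ∑ y ∈ Bᶜ, φ (insert y B) with hψ
  have hφ0 : ∀ V : Finset ι, ∑ x ∈ V, φ (V.erase x) = 0 := by
    intro V
    by_cases hV : V.card = k + 1
    · rw [← hf V hV]
      refine Finset.sum_congr rfl fun x hx => ?_
      simp [hφ, Finset.card_erase_of_mem hx, hV]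
    · refine Finset.sum_eq_zero fun x hx => ?_
      have := Finset.card_erase_add_one hx
      simp only [hφ]
      rw [if_neg (by omega)]
  have key : ∀ B : Finset ι,
      ((Fintype.card ι : ℚ) - 2 * k) * φ B + ∑ x ∈ B, ψ (B.erase x) = 0 := by
    intro B
    have h1 : ∑ y ∈ Bᶜ, (φ B + ∑ x ∈ B, φ (insert y (B.erase x))) = 0 := by
      refine Finset.sum_eq_zero fun y hy => ?_
      rw [Finset.mem_compl] at hy
      have := hφ0 (insert y B)
      rw [Finset.sum_insert hy, Finset.erase_insert hy] at this
      rw [← this]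
      congr 1
      refine Finset.sum_congr rfl fun x hx => ?_
      rw [Finset.erase_insert_of_ne (by rintro rfl; exact hy hx)]
    have h2 : ∀ x ∈ B, ψ (B.erase x) = φ B + ∑ y ∈ Bᶜ, φ (insert y (B.erase x)) := by
      intro x hx
      simp only [hψ]
      rw [Finset.compl_erase, Finset.sum_insert (by simpa using hx), Finset.insert_erase hx]
    rw [Finset.sum_add_distrib, Finset.sum_comm, Finset.sum_const, nsmul_eq_mul,
      Finset.card_compl, Nat.cast_sub (Finset.card_le_univ _)] at h1
    rw [Finset.sum_congr rfl h2, Finset.sum_add_distrib, Finset.sum_const, nsmul_eq_mul]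
    by_cases hB : B.card = k
    · rw [hB] at h1 ⊢
      linarith
    · have : φ B = 0 := by simp [hφ, hB]
      rw [this] at h1 ⊢
      linarith
  have h3 : ((Fintype.card ι : ℚ) - 2 * k) * ∑ B, φ B ^ 2 + ∑ B, ψ B ^ 2 = 0 := by
    have h4 : ∑ B, ψ B ^ 2 = ∑ B, ∑ x ∈ B, φ B * ψ (B.erase x) := by
      rw [sum_mem_erase_eq_sum_notMem_insert]
      refine Finset.sum_congr rfl fun B _ => ?_
      rw [← Finset.sum_mul, sq]
    rw [h4, Finset.mul_sum, ← Finset.sum_add_distrib]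
    refine Finset.sum_eq_zero fun B _ => ?_
    rw [← Finset.mul_sum]
    linear_combination φ B * key B
  have hpos : (0 : ℚ) < (Fintype.card ι : ℚ) - 2 * k := by
    have : (2 * k : ℚ) < Fintype.card ι := by exact_mod_cast hk
    linarith
  have h5 : (0 : ℚ) ≤ ∑ B, ψ B ^ 2 := Finset.sum_nonneg fun _ _ => sq_nonneg _
  have h6 : φ A ^ 2 ≤ ∑ B, φ B ^ 2 :=
    Finset.single_le_sum (f := fun B => φ B ^ 2) (fun _ _ => sq_nonneg _) (Finset.mem_univ A)
  have h7 : φ A ^ 2 ≤ 0 := by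
    by_contra! h
    have := mul_pos hpos (h.trans_le h6)
    linarith
  have h8 : φ A = 0 := by
    rw [← sq_eq_zero_iff]; exact le_antisymm h7 (sq_nonneg _)
  simpa [hφ, hA] using h8

/-- The solution `f` of `(d - |V|) f(V) + ∑ x ∈ V, f(V \ {x}) = h(V)` for `|V| < d`. -/
def layerSolution (d : ℕ) (h : Finset ι → ℚ) (V : Finset ι) : ℚ :=
  (h V - ∑ x ∈ V.attach, layerSolution d h (V.erase x)) / ((d : ℚ) - V.card)
termination_by V.card
decreasing_by exact Finset.card_erase_lt_of_mem x.2

lemma layerSolution_spec {ι : Type*} [DecidableEq ι] {d : ℕ} (h : Finset ι → ℚ) {V : Finset ι}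
    (hV : V.card < d) :
    ((d : ℚ) - V.card) * layerSolution d h V + ∑ x ∈ V, layerSolution d h (V.erase x) = h V := by
  have hd : ((d : ℚ) - V.card) ≠ 0 := by
    have : (V.card : ℚ) < d := by exact_mod_cast hV
    linarith
  rw [layerSolution, ← Finset.sum_attach V fun x => layerSolution d h (V.erase x)]
  field_simp
  ring

lemma layerSolution_eq_inv {ι : Type*} [DecidableEq ι] {d : ℕ} {h : Finset ι → ℚ} :
    ∀ V : Finset ι, V.card < d → (∀ W ⊆ V, h W = 1) → layerSolution d h V = 1 / d := by
  intro V
  induction V using Finset.strongInduction with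
  | H V ih =>
    intro hV h1
    have hs := layerSolution_spec h hV
    have hlt : (V.card : ℚ) < d := by exact_mod_cast hV
    have hd : (d : ℚ) ≠ 0 := by
      have : (0 : ℚ) ≤ V.card := Nat.cast_nonneg _
      linarith
    rw [h1 V subset_rfl, Finset.sum_congr rfl fun x hx => ih (V.erase x) (Finset.erase_ssubset hx)
      ((Finset.card_erase_lt_of_mem hx).trans hV)
      fun W hW => h1 W (hW.trans (Finset.erase_subset _ _)), Finset.sum_const, nsmul_eq_mul] at hs
    have hne : (d : ℚ) - V.card ≠ 0 := by linarith
    apply mul_left_cancel₀ hne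
    linear_combination hs - mul_one_div_cancel hd

lemma layerSolution_insert {ι : Type*} [DecidableEq ι] {d : ℕ} {h : Finset ι → ℚ} {x : ι} :
    ∀ W : Finset ι, x ∉ W → W.card + 1 < d → (∀ W' ⊆ W, h (insert x W') = h W') →
      layerSolution d h (insert x W) = layerSolution d h W := by
  intro W
  induction W using Finset.strongInduction with
  | H W ih =>
    intro hx hW hins
    have hc : (insert x W).card = W.card + 1 := Finset.card_insert_of_notMem hx
    have h1 := layerSolution_spec h (V := insert x W) (d := d) (by omega)
    have h2 := layerSolution_spec h (V := W) (d := d) (by omega)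
    have h3 : ∀ y ∈ W, layerSolution d h ((insert x W).erase y) =
        layerSolution d h (W.erase y) := by
      intro y hy
      rw [Finset.erase_insert_of_ne (by rintro rfl; exact hx hy)]
      refine ih _ (Finset.erase_ssubset hy) (fun hm => hx (Finset.mem_of_mem_erase hm))
        (by have := Finset.card_erase_lt_of_mem hy; omega)
        fun W' hW' => hins W' (hW'.trans (Finset.erase_subset _ _))
    rw [Finset.sum_insert hx, Finset.erase_insert hx, Finset.sum_congr rfl h3, hc,
      hins W subset_rfl] at h1
    push_cast at h1
    have hne : (d : ℚ) - (W.card + 1) ≠ 0 := by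
      have : ((W.card + 1 : ℕ) : ℚ) < d := by exact_mod_cast hW
      push_cast at this
      linarith
    apply mul_left_cancel₀ hne
    linarith

/-- A union-closed family of nonempty sets which meets the powerset of every `d`-set contains
a `d`-set, provided that the ground set has at least `2 * d` elements. -/
lemma exists_card_eq_of_unionClosed {d : ℕ} (hd : 2 * d ≤ Fintype.card ι) (C : Finset (Finset ι))
    (hempty : ∅ ∉ C) (hunion : ∀ A ∈ C, ∀ B ∈ C, A ∪ B ∈ C)
    (hcover : ∀ D : Finset ι, D.card = d → ∃ U ∈ C, U ⊆ D) : ∃ D ∈ C, D.card = d := by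
  by_contra! hcard
  have hd0 : 0 < d := by
    rw [Nat.pos_iff_ne_zero]
    rintro rfl
    obtain ⟨U, hU, hU'⟩ := hcover ∅ rfl
    rw [Finset.subset_empty.1 hU'] at hU
    exact hempty hU
  set h : Finset ι → ℚ := fun V => if ∃ U ∈ C, U ⊆ V then 0 else 1 with hh
  have hfree : ∀ D : Finset ι, D.card = d → ∃ x ∈ D, ∀ U ∈ C, U ⊆ D → x ∉ U := by
    intro D hD
    by_contra! hx
    obtain ⟨U, hU, hUD⟩ := hcover D hD
    have hmem : (C.filter (· ⊆ D)).sup id ∈ (C : Set (Finset ι)) := by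
      have hne : (C.filter (· ⊆ D)).Nonempty := ⟨U, by simp [hU, hUD]⟩
      rw [← Finset.sup'_eq_sup hne]
      refine Finset.sup'_mem (C : Set (Finset ι)) (fun A hA B hB => hunion A hA B hB) _ _ _
        fun A hA => ?_
      exact (Finset.mem_filter.1 hA).1
    refine hcard _ hmem ?_
    rw [← hD]
    congr 1
    refine le_antisymm (Finset.sup_le fun A hA => (Finset.mem_filter.1 hA).2) fun x hxD => ?_
    obtain ⟨A, hA, hAD, hxA⟩ := hx x hxD
    exact Finset.le_sup (f := id) (Finset.mem_filter.2 ⟨hA, hAD⟩) hxA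
  have htop : ∀ D : Finset ι, D.card = d → ∑ x ∈ D, layerSolution d h (D.erase x) = 0 := by
    intro D hD
    obtain ⟨x, hxD, hx⟩ := hfree D hD
    set W := D.erase x with hW
    have hxW : x ∉ W := Finset.notMem_erase x D
    have hDW : insert x W = D := Finset.insert_erase hxD
    have hWc : W.card + 1 = d := by rw [← hD]; exact Finset.card_erase_add_one hxD
    have hins : ∀ W' ⊆ W, h (insert x W') = h W' := by
      intro W' hW'
      have : (∃ U ∈ C, U ⊆ insert x W') ↔ ∃ U ∈ C, U ⊆ W' := by
        refine ⟨?_, fun ⟨U, hU, hUW⟩ => ⟨U, hU, hUW.trans (Finset.subset_insert _ _)⟩⟩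
        rintro ⟨U, hU, hUW⟩
        refine ⟨U, hU, (Finset.subset_insert_iff_of_notMem (hx U hU ?_)).1 hUW⟩
        exact hUW.trans (hDW ▸ Finset.insert_subset_insert x hW')
      simp only [hh, this]
    have hhD : h D = 0 := if_pos (hcover D hD)
    have hspec := layerSolution_spec h (V := W) (d := d) (by omega)
    have h1 : (d : ℚ) - W.card = 1 := by rw [← hWc]; push_cast; ring
    rw [← hins W subset_rfl, hDW, hhD, h1, one_mul] at hspec
    rw [← hDW, Finset.sum_insert hxW, Finset.erase_insert hxW, ← hspec]
    congr 1
    refine Finset.sum_congr rfl fun y hy => ?_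
    rw [Finset.erase_insert_of_ne (by rintro rfl; exact hxW hy)]
    refine layerSolution_insert _ (fun hm => hxW (Finset.mem_of_mem_erase hm)) ?_
      fun W' hW' => hins W' (hW'.trans (Finset.erase_subset _ _))
    have := Finset.card_erase_lt_of_mem hy
    omega
  have hlayer : ∀ k < d, ∀ V : Finset ι, V.card = d - 1 - k → layerSolution d h V = 0 := by
    intro k
    induction k with
    | zero =>
      intro _
      exact eq_zero_of_sum_erase_eq_zero (by omega) _ fun V hV => htop V (by omega)
    | succ k ih =>
      intro hk
      refine eq_zero_of_sum_erase_eq_zero (by omega) _ fun V hV => ?_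
      have h0 := ih (by omega) V (by omega)
      have hspec := layerSolution_spec h (V := V) (d := d) (by omega)
      have hhV : h V = 0 := by
        by_contra hne
        have hnot : ¬ ∃ U ∈ C, U ⊆ V := fun hex => hne (if_pos hex)
        rw [layerSolution_eq_inv V (by omega) fun W hW =>
          if_neg fun ⟨U, hU, hUW⟩ => hnot ⟨U, hU, hUW.trans hW⟩] at h0
        have : (d : ℚ) ≠ 0 := by exact_mod_cast hd0.ne'
        simp [this] at h0
      rw [h0, hhV, mul_zero, zero_add] at hspec
      exact hspec
  have h0 := hlayer (d - 1) (by omega) ∅ (by simp)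
  rw [layerSolution_eq_inv ∅ (by simpa) fun W hW => if_neg ?_] at h0
  · have : (d : ℚ) ≠ 0 := by exact_mod_cast hd0.ne'
    simp [this] at h0
  · rintro ⟨U, hU, hUW⟩
    rw [Finset.subset_empty.1 (hUW.trans hW)] at hU
    exact hempty hU

/-- The dual form of `exists_card_eq_of_unionClosed` for intersection-closed families. -/
lemma exists_card_eq_of_interClosed {s : ℕ} (hs : s ≤ Fintype.card ι)
    (hs2 : Fintype.card ι ≤ 2 * s) (J : Finset (Finset ι)) (huniv : Finset.univ ∉ J)
    (hinter : ∀ A ∈ J, ∀ B ∈ J, A ∩ B ∈ J)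
    (hcover : ∀ A : Finset ι, A.card = s → ∃ B ∈ J, A ⊆ B) : ∃ A ∈ J, A.card = s := by
  have hunion : ∀ A ∈ J.image compl, ∀ B ∈ J.image compl, A ∪ B ∈ J.image compl := by
    simp only [Finset.mem_image]
    rintro _ ⟨A, hA, rfl⟩ _ ⟨B, hB, rfl⟩
    exact ⟨A ∩ B, hinter A hA B hB, Finset.compl_inter _ _⟩
  have hcover' : ∀ D : Finset ι, D.card = Fintype.card ι - s → ∃ U ∈ J.image compl, U ⊆ D := by
    intro D hD
    obtain ⟨B, hB, hDB⟩ := hcover Dᶜ (by rw [Finset.card_compl]; omega)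
    exact ⟨Bᶜ, Finset.mem_image_of_mem _ hB, by
      rw [← compl_compl D]; exact Finset.compl_subset_compl.2 hDB⟩
  obtain ⟨D, hD, hDc⟩ := exists_card_eq_of_unionClosed (by omega) (J.image compl)
    (by simpa using huniv) hunion hcover'
  obtain ⟨A, hA, rfl⟩ := Finset.mem_image.1 hD
  refine ⟨A, hA, ?_⟩
  have := Finset.card_le_univ A
  rw [Finset.card_compl] at hDc
  omega

end SubsetSums

section Codes

variable {ι V : Type*} [Fintype ι] [DecidableEq V]

/-- The set of coordinates in which two words agree. -/
def agree (f g : ι → V) : Finset ι := Finset.univ.filter fun i => f i = g i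

lemma mem_agree {f g : ι → V} {i : ι} : i ∈ agree f g ↔ f i = g i := by simp [agree]

lemma agree_eq_univ {f g : ι → V} : agree f g = Finset.univ ↔ f = g := by
  simp [Finset.ext_iff, mem_agree, funext_iff]

variable [DecidableEq ι]

/-- The agreement sets of pairs of distinct words of `F`. -/
def agreeTypes (F : Finset (ι → V)) : Finset (Finset ι) := F.offDiag.image fun p => agree p.1 p.2

lemma mem_agreeTypes {F : Finset (ι → V)} {A : Finset ι} :
    A ∈ agreeTypes F ↔ ∃ f ∈ F, ∃ g ∈ F, f ≠ g ∧ agree f g = A := by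
  simp only [agreeTypes, Finset.mem_image, Finset.mem_offDiag, Prod.exists]
  constructor
  · rintro ⟨f, g, ⟨hf, hg, hne⟩, h⟩
    exact ⟨f, hf, g, hg, hne, h⟩
  · rintro ⟨f, hf, g, hg, hne, h⟩
    exact ⟨f, g, ⟨hf, hg, hne⟩, h⟩

lemma univ_notMem_agreeTypes (F : Finset (ι → V)) : Finset.univ ∉ agreeTypes F := by
  rw [mem_agreeTypes]
  rintro ⟨f, _, g, _, hne, h⟩
  exact hne (agree_eq_univ.1 h)

/-- `f` restricted to `A` is the kernel of a sunflower of `k` words of `F`. -/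
def IsKernel (F : Finset (ι → V)) (k : ℕ) (A : Finset ι) (f : ι → V) : Prop :=
  ∃ P ⊆ F, P.card = k ∧ (∀ g ∈ P, ∀ i ∈ A, g i = f i) ∧
    ∀ g ∈ P, ∀ h ∈ P, g ≠ h → ∀ i ∉ A, g i ≠ h i

lemma IsKernel.exists_forall_ne {F : Finset (ι → V)} {k : ℕ} {A : Finset ι} {f : ι → V}
    (h : IsKernel F k A f) (hk : Fintype.card ι < k) (f' : ι → V) :
    ∃ g ∈ F, (∀ i ∈ A, g i = f i) ∧ ∀ i ∉ A, g i ≠ f' i := by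
  obtain ⟨P, hPF, hPk, hPA, hP⟩ := h
  by_contra! hno
  have hex : ∀ g : P, ∃ i, i ∉ A ∧ g.1 i = f' i := fun g => hno g.1 (hPF g.2) (hPA g.1 g.2)
  choose c hcA hc using hex
  obtain ⟨g, h, hne, hgh⟩ := Fintype.exists_ne_map_eq_of_card_lt c (by simpa [hPk] using hk)
  refine hP g.1 g.2 h.1 h.2 (fun he => hne (Subtype.ext he)) (c g) (hcA g) ?_
  rw [hc g, hgh, hc h]

lemma IsKernel.exists_agree_eq_inter {F : Finset (ι → V)} {k : ℕ} {A B : Finset ι} {f : ι → V}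
    (hA : IsKernel F k A f) (hB : IsKernel F k B f) (hk : Fintype.card ι < k) :
    ∃ g ∈ F, ∃ h ∈ F, agree g h = A ∩ B := by
  obtain ⟨g, hg, hgA, hgA'⟩ := hA.exists_forall_ne hk f
  obtain ⟨h, hh, hhB, hhB'⟩ := hB.exists_forall_ne hk g
  refine ⟨g, hg, h, hh, ?_⟩
  ext i
  rw [mem_agree, Finset.mem_inter]
  constructor
  · intro hi
    have hiB : i ∈ B := by
      by_contra hiB
      exact hhB' i hiB hi.symm
    refine ⟨?_, hiB⟩
    by_contra hiA
    exact hgA' i hiA (hi.trans (hhB i hiB))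
  · rintro ⟨hiA, hiB⟩
    rw [hgA i hiA, hhB i hiB]

/-- Words agreeing on `A` without a sunflower of size `k` with kernel `A` contain a positive
proportion of words sharing a further coordinate. -/
lemma exists_large_agree_ne_of_fiber {G : Finset (ι → V)} {k : ℕ} {A : Finset ι}
    (hA : A ≠ Finset.univ) (f : ι → V) (hG : ∀ g ∈ G, ∀ i ∈ A, g i = f i)
    (hker : ¬ IsKernel G k A f) :
    ∃ T ⊆ G, G.card ≤ k * Fintype.card ι * T.card ∧ ∀ g ∈ T, ∀ h ∈ T, agree g h ≠ A := by
  classical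
  set S := G.powerset.filter fun P => ∀ g ∈ P, ∀ h ∈ P, g ≠ h → ∀ i ∉ A, g i ≠ h i with hS
  have hSne : S.Nonempty := ⟨∅, by simp [hS]⟩
  obtain ⟨P, hPS, hPmax⟩ := S.exists_max_image Finset.card hSne
  obtain ⟨hPG, hP⟩ := Finset.mem_filter.1 hPS
  rw [Finset.mem_powerset] at hPG
  have hPk : P.card < k := by
    by_contra! hle
    obtain ⟨Q, hQP, hQ⟩ := Finset.exists_subset_card_eq hle
    exact hker ⟨Q, hQP.trans hPG, hQ, fun g hg => hG g (hPG (hQP hg)),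
      fun g hg h hh => hP g (hQP hg) h (hQP hh)⟩
  have hcov : ∀ g ∈ G, ∃ p ∈ P ×ˢ Aᶜ, g p.2 = p.1 p.2 := by
    intro g hg
    by_cases hgP : g ∈ P
    · obtain ⟨i, hi⟩ : ∃ i, i ∉ A := by
        by_contra! h
        exact hA (Finset.eq_univ_iff_forall.2 h)
      exact ⟨(g, i), by simp [hgP, hi], rfl⟩
    · by_contra! hno
      have hno' : ∀ p ∈ P, ∀ i ∉ A, g i ≠ p i := fun p hp i hi => hno (p, i) (by simp [hp, hi])
      have := hPmax (insert g P) (by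
        refine Finset.mem_filter.2 ⟨Finset.mem_powerset.2 (Finset.insert_subset hg hPG), ?_⟩
        intro a ha b hb hab i hi
        rcases Finset.mem_insert.1 ha with ha | ha <;> rcases Finset.mem_insert.1 hb with hb | hb
        · exact absurd (ha.trans hb.symm) hab
        · exact ha ▸ hno' b hb i hi
        · exact hb ▸ (hno' a ha i hi).symm
        · exact hP a ha b hb hab i hi)
      rw [Finset.card_insert_of_notMem hgP] at this
      omega
  rcases G.eq_empty_or_nonempty with rfl | hGne
  · exact ⟨∅, by simp⟩
  have hcne : (P ×ˢ Aᶜ).Nonempty := by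
    obtain ⟨g, hg⟩ := hGne
    obtain ⟨p, hp, _⟩ := hcov g hg
    exact ⟨p, hp⟩
  have : Nonempty ((ι → V) × ι) := hcne.to_type
  choose! c hc hgc using hcov
  obtain ⟨p, hp, hpmax⟩ := (P ×ˢ Aᶜ).exists_max_image (fun p => (G.filter (c · = p)).card) hcne
  refine ⟨G.filter (c · = p), Finset.filter_subset _ _, ?_, ?_⟩
  · calc G.card = ∑ q ∈ P ×ˢ Aᶜ, (G.filter (c · = q)).card :=
          Finset.card_eq_sum_card_fiberwise hc
      _ ≤ ∑ q ∈ P ×ˢ Aᶜ, (G.filter (c · = p)).card := Finset.sum_le_sum hpmax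
      _ = P.card * Aᶜ.card * (G.filter (c · = p)).card := by simp
      _ ≤ _ := by
        gcongr
        exact Finset.card_le_univ _
  · intro g hg h hh hgh
    rw [Finset.mem_filter] at hg hh
    have hi : p.2 ∉ A := by
      have := (Finset.mem_product.1 hp).2
      simpa using this
    refine hi (hgh ▸ mem_agree.2 ?_)
    have h1 := hgc g hg.1
    have h2 := hgc h hh.1
    rw [hg.2] at h1
    rw [hh.2] at h2
    rw [h1, h2]

/-- If no word of `G` is an `A`-kernel, then a positive proportion of `G` avoids the agreement
set `A`. -/
lemma exists_large_agree_ne {G : Finset (ι → V)} {k : ℕ} {A : Finset ι}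
    (hA : A ≠ Finset.univ) (hker : ∀ f ∈ G, ¬ IsKernel G k A f) :
    ∃ T ⊆ G, G.card ≤ k * Fintype.card ι * T.card ∧ A ∉ agreeTypes T := by
  classical
  set key : (ι → V) → (ι → Option V) := fun f i => if i ∈ A then some (f i) else none with hkey
  have hkeyeq : ∀ f g, key f = key g ↔ ∀ i ∈ A, f i = g i := by
    intro f g
    simp only [hkey, funext_iff]
    refine forall_congr' fun i => ?_
    by_cases hi : i ∈ A <;> simp [hi]
  have hfib : ∀ q, ∃ T ⊆ G.filter (key · = q),
      (G.filter (key · = q)).card ≤ k * Fintype.card ι * T.card ∧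
        ∀ g ∈ T, ∀ h ∈ T, agree g h ≠ A := by
    intro q
    rcases (G.filter (key · = q)).eq_empty_or_nonempty with he | ⟨f, hf⟩
    · exact ⟨∅, by simp, by simp [he], by simp⟩
    · rw [Finset.mem_filter] at hf
      refine exists_large_agree_ne_of_fiber hA f ?_ ?_
      · intro g hg
        rw [Finset.mem_filter] at hg
        exact (hkeyeq g f).1 (hg.2.trans hf.2.symm)
      · rintro ⟨P, hP, hP'⟩
        exact hker f hf.1 ⟨P, hP.trans (Finset.filter_subset _ _), hP'⟩
  choose T hTG hTc hTA using hfib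
  have hTkey : ∀ q, ∀ f ∈ T q, key f = q := fun q f hf => (Finset.mem_filter.1 (hTG q hf)).2
  refine ⟨(G.image key).biUnion T, ?_, ?_, ?_⟩
  · exact Finset.biUnion_subset.2 fun q _ => (hTG q).trans (Finset.filter_subset _ _)
  · rw [Finset.card_biUnion, Finset.mul_sum, Finset.card_eq_sum_card_image key G]
    · exact Finset.sum_le_sum fun q _ => hTc q
    · intro q _ q' _ hne
      refine Finset.disjoint_left.2 fun f hf hf' => hne ?_
      rw [← hTkey q f hf, hTkey q' f hf']
  · rw [mem_agreeTypes]
    rintro ⟨f, hf, g, hg, _, hfg⟩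
    obtain ⟨q, _, hfq⟩ := Finset.mem_biUnion.1 hf
    obtain ⟨q', _, hgq⟩ := Finset.mem_biUnion.1 hg
    have hqq : q = q' := by
      rw [← hTkey q f hfq, ← hTkey q' g hgq, hkeyeq]
      intro i hi
      rw [← hfg] at hi
      exact mem_agree.1 hi
    subst hqq
    exact hTA q f hfq g hgq hfg

/-- If every nonempty subfamily has a bad element, for a notion of badness inherited by
subfamilies, then the family can be coloured so that every monochromatic subfamily has an
element which is bad for its colour. -/
lemma exists_coloring_of_bad {α κ : Type*} [DecidableEq α] [Nonempty κ]
    (bad : Finset α → α → κ → Prop)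
    (hanti : ∀ G H f c, G ⊆ H → bad H f c → bad G f c) (F : Finset α)
    (hF : ∀ G ⊆ F, G.Nonempty → ∃ f ∈ G, ∃ c, bad G f c) :
    ∃ col : α → κ, ∀ G ⊆ F, G.Nonempty → ∀ c, (∀ f ∈ G, col f = c) → ∃ f ∈ G, bad G f c := by
  induction F using Finset.strongInduction with
  | H F ih =>
    rcases F.eq_empty_or_nonempty with rfl | hne
    · refine ⟨fun _ => Classical.arbitrary κ, fun G hG hGne => ?_⟩
      rw [Finset.subset_empty.1 hG] at hGne
      simp at hGne
    · obtain ⟨f, hf, c, hc⟩ := hF F subset_rfl hne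
      obtain ⟨col, hcol⟩ := ih (F.erase f) (Finset.erase_ssubset hf)
        fun G hG => hF G (hG.trans (Finset.erase_subset _ _))
      refine ⟨Function.update col f c, fun G hG hGne c' hc' => ?_⟩
      by_cases hfG : f ∈ G
      · have := hc' f hfG
        rw [Function.update_self] at this
        exact ⟨f, hfG, hanti G F f c' hG (this ▸ hc)⟩
      · refine hcol G (Finset.subset_erase.2 ⟨hG, hfG⟩) hGne c' fun g hg => ?_
        rw [← hc' g hg, Function.update_of_ne]
        rintro rfl
        exact hfG hg

/-- One step of the induction bounding the size of a code with a forbidden agreement number. -/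
lemma card_le_of_forall_agreeTypes [Fintype V] {s : ℕ} (hs : s ≤ Fintype.card ι)
    (hs2 : Fintype.card ι ≤ 2 * s) (F : Finset (ι → V)) (hF : ∀ A ∈ agreeTypes F, A.card ≠ s)
    (D : ℕ) (hD : ∀ A ∈ agreeTypes F, ∀ T ⊆ F, A ∉ agreeTypes T →
      T.card ≤ D * Fintype.card V ^ s) :
    F.card ≤ 2 ^ Fintype.card ι *
      (1 + (Fintype.card ι + 1) * Fintype.card ι * D) * Fintype.card V ^ s := by
  classical
  set k := Fintype.card ι + 1 with hk
  set J := agreeTypes F with hJ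
  set bad : Finset (ι → V) → (ι → V) → Finset ι ⊕ Finset ι → Prop := fun G f c =>
    Sum.elim (fun A => A.card = s ∧ ∀ g ∈ G, (∀ i ∈ A, g i = f i) → g = f)
      (fun A => A ∈ J ∧ ¬ IsKernel G k A f) c with hbad
  have hanti : ∀ G H f c, G ⊆ H → bad H f c → bad G f c := by
    rintro G H f (A | A) hGH
    · exact fun h => ⟨h.1, fun g hg => h.2 g (hGH hg)⟩
    · exact fun h => ⟨h.1, fun ⟨P, hP, hP'⟩ => h.2 ⟨P, hP.trans hGH, hP'⟩⟩
  have hex : ∀ G ⊆ F, G.Nonempty → ∃ f ∈ G, ∃ c, bad G f c := by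
    intro G hGF ⟨f, hf⟩
    by_contra! hno
    have hown : ∀ A : Finset ι, A.card = s → ∃ B ∈ J, A ⊆ B := by
      intro A hA
      have h1 := hno f hf (Sum.inl A)
      simp only [hbad, Sum.elim_inl, not_and, not_forall] at h1
      obtain ⟨g, hg, hgA, hne⟩ := h1 hA
      exact ⟨agree g f, mem_agreeTypes.2 ⟨g, hGF hg, f, hGF hf, hne, rfl⟩,
        fun i hi => mem_agree.2 (hgA i hi)⟩
    have hkern : ∀ A ∈ J, IsKernel G k A f := by
      intro A hA
      have h1 := hno f hf (Sum.inr A)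
      simp only [hbad, Sum.elim_inr, not_and, not_not] at h1
      exact h1 hA
    have hinter : ∀ A ∈ J, ∀ B ∈ J, A ∩ B ∈ J := by
      intro A hA B hB
      obtain ⟨g, hg, h, hh, hgh⟩ :=
        (hkern A hA).exists_agree_eq_inter (hkern B hB) (Nat.lt_succ_self _)
      refine mem_agreeTypes.2 ⟨g, hGF hg, h, hGF hh, ?_, hgh⟩
      intro he
      rw [agree_eq_univ.2 he] at hgh
      refine univ_notMem_agreeTypes F ?_
      rwa [← Finset.univ_subset_iff.1 (hgh ▸ Finset.inter_subset_left : Finset.univ ⊆ A)]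
    obtain ⟨A, hA, hAs⟩ :=
      exists_card_eq_of_interClosed hs hs2 J (univ_notMem_agreeTypes F) hinter hown
    exact hF A hA hAs
  obtain ⟨col, hcol⟩ := exists_coloring_of_bad bad hanti F hex
  have hsub : ∀ c, F.filter (col · = c) ⊆ F := fun c => Finset.filter_subset _ _
  have hmono : ∀ c, ∀ f ∈ F.filter (col · = c), col f = c := fun c f hf =>
    (Finset.mem_filter.1 hf).2
  have hinl : ∀ A, (F.filter (col · = Sum.inl A)).card ≤ Fintype.card V ^ s := by
    intro A
    rcases (F.filter (col · = Sum.inl A)).eq_empty_or_nonempty with he | hne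
    · simp [he]
    · obtain ⟨_, _, hA, _⟩ := hcol _ (hsub _) hne _ (hmono _)
      have hinj : Set.InjOn (fun (f : ι → V) (i : A) => f i)
          (F.filter (col · = Sum.inl A) : Finset (ι → V)) := by
        intro f hf g hg hfg
        have hfg' : ∀ i ∈ A, f i = g i := fun i hi => congrFun hfg ⟨i, hi⟩
        obtain ⟨h, hh, _, hown⟩ := hcol {f, g}
          (Finset.insert_subset (hsub _ hf) (Finset.singleton_subset_iff.2 (hsub _ hg)))
          (by simp) (Sum.inl A) (by
            simp only [Finset.mem_insert, Finset.mem_singleton, forall_eq_or_imp, forall_eq]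
            exact ⟨hmono _ f hf, hmono _ g hg⟩)
        rw [Finset.mem_insert, Finset.mem_singleton] at hh
        rcases hh with rfl | rfl
        · exact (hown g (by simp) fun i hi => (hfg' i hi).symm).symm
        · exact hown f (by simp) hfg'
      have := Finset.card_le_card_of_injOn (t := Finset.univ) _ (fun _ _ => Finset.mem_univ _) hinj
      simpa [hA] using this
  have hinr : ∀ A, (F.filter (col · = Sum.inr A)).card ≤
      k * Fintype.card ι * (D * Fintype.card V ^ s) := by
    intro A
    rcases (F.filter (col · = Sum.inr A)).eq_empty_or_nonempty with he | hne
    · simp [he]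
    · obtain ⟨_, _, hA, _⟩ := hcol _ (hsub _) hne _ (hmono _)
      have hAu : A ≠ Finset.univ := by
        rintro rfl
        exact univ_notMem_agreeTypes F hA
      obtain ⟨T, hT, hTc, hTA⟩ := exists_large_agree_ne
          (G := F.filter (col · = Sum.inr A)) (k := k) hAu (by
        intro f hf ⟨P, hP, hPk, hPA, hP'⟩
        obtain ⟨p, hp⟩ : P.Nonempty := by
          rw [← Finset.card_pos]; omega
        obtain ⟨h, hh, _, hker⟩ := hcol P (hP.trans (hsub _)) ⟨p, hp⟩ _
          fun g hg => hmono _ g (hP hg)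
        exact hker ⟨P, subset_rfl, hPk,
          fun g hg i hi => (hPA g hg i hi).trans (hPA h hh i hi).symm, hP'⟩)
      exact hTc.trans (Nat.mul_le_mul_left _ (hD A hA T (hT.trans (hsub _)) hTA))
  calc F.card = ∑ c, (F.filter (col · = c)).card :=
        Finset.card_eq_sum_card_fiberwise fun _ _ => Finset.mem_univ _
    _ ≤ ∑ A : Finset ι, Fintype.card V ^ s +
        ∑ A : Finset ι, k * Fintype.card ι * (D * Fintype.card V ^ s) := by
      rw [Fintype.sum_sum_type]
      exact Nat.add_le_add (Finset.sum_le_sum fun A _ => hinl A)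
        (Finset.sum_le_sum fun A _ => hinr A)
    _ = _ := by
      simp only [Finset.sum_const, Finset.card_univ, Fintype.card_finset, smul_eq_mul]
      ring

/-- A code of length at most `2 * s` in which no two words agree in exactly `s` coordinates has
`O(q ^ s)` words, where `q` is the size of the alphabet. -/
lemma exists_card_le_of_forall_agreeTypes {s : ℕ} (hs : s ≤ Fintype.card ι)
    (hs2 : Fintype.card ι ≤ 2 * s) :
    ∃ C : ℕ, ∀ n : ℕ, ∀ F : Finset (ι → Fin n), (∀ A ∈ agreeTypes F, A.card ≠ s) →
      F.card ≤ C * n ^ s := by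
  have key : ∀ m : ℕ, ∃ C : ℕ, ∀ n : ℕ, ∀ F : Finset (ι → Fin n), (agreeTypes F).card ≤ m →
      (∀ A ∈ agreeTypes F, A.card ≠ s) → F.card ≤ C * n ^ s := by
    intro m
    induction m with
    | zero =>
      refine ⟨2 ^ Fintype.card ι * (1 + (Fintype.card ι + 1) * Fintype.card ι * 0),
        fun n F hm hF => ?_⟩
      have hempty : agreeTypes F = ∅ := Finset.card_eq_zero.1 (Nat.le_zero.1 hm)
      have := card_le_of_forall_agreeTypes hs hs2 F hF 0 (by simp [hempty])
      rwa [Fintype.card_fin] at this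
    | succ m ih =>
      obtain ⟨D, hD⟩ := ih
      refine ⟨2 ^ Fintype.card ι * (1 + (Fintype.card ι + 1) * Fintype.card ι * D),
        fun n F hm hF => ?_⟩
      have := card_le_of_forall_agreeTypes hs hs2 F hF D (by
        intro A hA T hT hAT
        have hsub : agreeTypes T ⊆ agreeTypes F :=
          Finset.image_subset_image (Finset.offDiag_mono hT)
        rw [Fintype.card_fin]
        refine hD n T ?_ fun B hB => hF B (hsub hB)
        have := Finset.card_lt_card (Finset.ssubset_iff_subset_ne.2
          ⟨hsub, fun he => hAT (he ▸ hA)⟩)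
        omega)
      rwa [Fintype.card_fin] at this
  obtain ⟨C, hC⟩ := key (Fintype.card (Finset ι))
  exact ⟨C, fun n F => hC n F (Finset.card_le_univ _)⟩

end Codes

section UpperBound

variable {r n : ℕ}

lemma card_image_inter_image_eq_card_agree {c : Fin n → Fin r} {f g : Fin r → Fin n}
    (hf : ∀ i, c (f i) = i) (hg : ∀ i, c (g i) = i) :
    (Finset.univ.image f ∩ Finset.univ.image g).card = (agree f g).card := by
  rw [← Finset.card_image_of_injective (agree f g) (Function.LeftInverse.injective hf)]
  congr 1
  ext v
  simp only [Finset.mem_inter, Finset.mem_image, Finset.mem_univ, true_and, mem_agree]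
  constructor
  · rintro ⟨⟨i, rfl⟩, j, hj⟩
    have hij : j = i := by rw [← hg j, hj, hf i]
    exact ⟨i, by rw [← hj, hij], rfl⟩
  · rintro ⟨i, hi, rfl⟩
    exact ⟨⟨i, rfl⟩, i, hi.symm⟩

/-- The colourings for which a given injective tuple is rainbow in the prescribed order form a
proportion of at least `1 / r ^ r` of all colourings. -/
lemma pow_le_mul_card_rainbow {f : Fin r → Fin n} (hf : Function.Injective f) :
    r ^ n ≤ r ^ r * (Finset.univ.filter fun c : Fin n → Fin r => ∀ i, c (f i) = i).card := by
  classical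
  set ov : (Fin n → Fin r) → Fin n → Fin r := fun c v =>
    if h : ∃ i, f i = v then h.choose else c v with hov
  have hovf : ∀ c i, ov c (f i) = i := by
    intro c i
    have h : ∃ j, f j = f i := ⟨i, rfl⟩
    simp only [hov, dif_pos h]
    exact hf h.choose_spec
  have hinj : Set.InjOn (fun c : Fin n → Fin r => ((fun i => c (f i) : Fin r → Fin r), ov c))
      (Finset.univ : Finset (Fin n → Fin r)) := by
    intro c _ c' _ h
    obtain ⟨h1, h2⟩ := Prod.mk.inj h
    funext v
    by_cases hv : ∃ i, f i = v
    · obtain ⟨i, rfl⟩ := hv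
      exact congrFun h1 i
    · have := congrFun h2 v
      simpa only [hov, dif_neg hv] using this
  have := Finset.card_le_card_of_injOn
    (t := (Finset.univ : Finset (Fin r → Fin r)) ×ˢ
      Finset.univ.filter fun c : Fin n → Fin r => ∀ i, c (f i) = i) _
    (fun c _ => by
      simp only [Finset.coe_product, Set.mem_prod, Finset.mem_coe, Finset.mem_univ,
        Finset.mem_filter, true_and]
      exact hovf c) hinj
  simpa using this

lemma cliqueCount_le_of_bFree {s C : ℕ} (hr : 0 < r)
    (hC : ∀ F : Finset (Fin r → Fin n), (∀ A ∈ agreeTypes F, A.card ≠ s) → F.card ≤ C * n ^ s)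
    {G : SimpleGraph (Fin n)} (hG : BFree G r s) : cliqueCount G r ≤ r ^ r * C * n ^ s := by
  classical
  set Q := Finset.univ.filter fun f : Fin r → Fin n =>
    Function.Injective f ∧ G.IsNClique r (Finset.univ.image f) with hQ
  have hcount : cliqueCount G r ≤ Q.card := by
    have hsub : {S : Finset (Fin n) | G.IsNClique r S} ⊆
        (Q.image fun f => Finset.univ.image f : Finset (Finset (Fin n))) := by
      intro S hS
      have himg : Finset.univ.image (S.orderEmbOfFin hS.card_eq) = S := by
        rw [← Finset.coe_inj]
        simp
      rw [Finset.mem_coe, Finset.mem_image]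
      refine ⟨S.orderEmbOfFin hS.card_eq, ?_, himg⟩
      simp only [hQ, Finset.mem_filter, Finset.mem_univ, true_and, himg]
      exact ⟨(S.orderEmbOfFin hS.card_eq).injective, hS⟩
    calc cliqueCount G r ≤ (Q.image fun f => Finset.univ.image f).card := by
          rw [cliqueCount, ← Set.ncard_coe_finset]
          exact Set.ncard_le_ncard hsub (Finset.finite_toSet _)
      _ ≤ Q.card := Finset.card_image_le
  have hcolour : ∀ c : Fin n → Fin r, (Q.filter fun f => ∀ i, c (f i) = i).card ≤ C * n ^ s := by
    intro c
    refine hC _ fun A hA => ?_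
    obtain ⟨f, hf, g, hg, _, rfl⟩ := mem_agreeTypes.1 hA
    simp only [hQ, Finset.mem_filter, Finset.mem_univ, true_and] at hf hg
    rw [← card_image_inter_image_eq_card_agree hf.2 hg.2]
    -- the two intersections may be taken with different decidability instances
    convert hG _ _ hf.1.2 hg.1.2
  have hdouble : Q.card * r ^ n ≤ r ^ r * (r ^ n * (C * n ^ s)) :=
    calc Q.card * r ^ n = ∑ f ∈ Q, r ^ n := by simp
      _ ≤ ∑ f ∈ Q, r ^ r *
          (Finset.univ.filter fun c : Fin n → Fin r => ∀ i, c (f i) = i).card :=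
        Finset.sum_le_sum fun f hf => pow_le_mul_card_rainbow (Finset.mem_filter.1 hf).2.1
      _ = r ^ r * ∑ c : Fin n → Fin r, (Q.filter fun f => ∀ i, c (f i) = i).card := by
        rw [← Finset.mul_sum]
        congr 1
        exact Finset.sum_card_bipartiteAbove_eq_sum_card_bipartiteBelow
          fun (f : Fin r → Fin n) (c : Fin n → Fin r) => ∀ i, c (f i) = i
      _ ≤ r ^ r * ∑ c : Fin n → Fin r, C * n ^ s := by
        gcongr with c
        exact hcolour c
      _ = r ^ r * (r ^ n * (C * n ^ s)) := by simp
  refine hcount.trans (Nat.le_of_mul_le_mul_right (c := r ^ n) ?_ (by positivity))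
  calc Q.card * r ^ n ≤ _ := hdouble
    _ = _ := by ring

end UpperBound

section LowerBound

variable {t m : ℕ} {a : Fin t → ℕ}

/-- The join over `i` of `m` disjoint copies of the complete graph on `a i` vertices. -/
def blockGraph (m : ℕ) (a : Fin t → ℕ) : SimpleGraph (Fin m × Σ i, Fin (a i)) where
  Adj v w := v ≠ w ∧ (v.2.1 = w.2.1 → v.1 = w.1)
  symm := ⟨fun _ _ h => ⟨h.1.symm, fun he => (h.2 he.symm).symm⟩⟩
  loopless := ⟨fun _ h => h.1 rfl⟩

/-- The vertex set of the clique consisting of the `b i`-th block of every part `i`. -/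
def blockClique (a : Fin t → ℕ) (b : Fin t → Fin m) : Finset (Fin m × Σ i, Fin (a i)) :=
  Finset.univ.image fun p : Σ i, Fin (a i) => (b p.1, p)

lemma mem_blockClique {b : Fin t → Fin m} {v : Fin m × Σ i, Fin (a i)} :
    v ∈ blockClique a b ↔ b v.2.1 = v.1 := by
  simp only [blockClique, Finset.mem_image, Finset.mem_univ, true_and]
  constructor
  · rintro ⟨p, rfl⟩
    rfl
  · intro h
    exact ⟨v.2, by rw [h]⟩

lemma isNClique_blockClique (b : Fin t → Fin m) :
    (blockGraph m a).IsNClique (∑ i, a i) (blockClique a b) := by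
  rw [SimpleGraph.isNClique_iff]
  constructor
  · intro v hv w hw hne
    rw [Finset.mem_coe, mem_blockClique] at hv hw
    exact ⟨hne, fun he => by rw [← hv, ← hw, he]⟩
  · rw [blockClique, Finset.card_image_of_injective]
    · simp
    · intro p q h
      exact (Prod.mk.inj h).2

lemma blockClique_injective (ha : ∀ i, 0 < a i) :
    Function.Injective (blockClique (m := m) a) := by
  intro b b' h
  funext i
  have hmem : (b i, ⟨i, ⟨0, ha i⟩⟩) ∈ blockClique a b := mem_blockClique.2 rfl
  rw [h, mem_blockClique] at hmem
  exact hmem.symm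

lemma exists_eq_blockClique (ha : ∀ i, 0 < a i) {S : Finset (Fin m × Σ i, Fin (a i))}
    (hS : (blockGraph m a).IsNClique (∑ i, a i) S) : ∃ b, S = blockClique a b := by
  have hblock : ∀ v ∈ S, ∀ w ∈ S, v.2.1 = w.2.1 → v.1 = w.1 := by
    intro v hv w hw he
    by_cases hvw : v = w
    · rw [hvw]
    · exact (hS.isClique hv hw hvw).2 he
  have hinj : Set.InjOn Prod.snd (S : Set (Fin m × Σ i, Fin (a i))) := by
    intro v hv w hw he
    exact Prod.ext (hblock v hv w hw (by rw [he])) he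
  have himg : S.image Prod.snd = Finset.univ := by
    rw [← Finset.card_eq_iff_eq_univ, Finset.card_image_of_injOn hinj, hS.card_eq]
    simp
  have hex : ∀ p : Σ i, Fin (a i), ∃ v ∈ S, v.2 = p := by
    intro p
    have := Finset.mem_univ p
    rwa [← himg, Finset.mem_image] at this
  choose v hvS hv using hex
  refine ⟨fun i => (v ⟨i, ⟨0, ha i⟩⟩).1, Finset.eq_of_subset_of_card_le ?_ ?_⟩
  · intro w hw
    rw [mem_blockClique]
    exact hblock _ (hvS _) _ hw (by rw [hv])
  · rw [hS.card_eq, (isNClique_blockClique _).card_eq]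

lemma card_blockClique_inter (b b' : Fin t → Fin m) :
    (blockClique a b ∩ blockClique a b').card =
      ∑ i ∈ Finset.univ.filter (fun i => b i = b' i), a i := by
  have h : blockClique a b ∩ blockClique a b' =
      ((Finset.univ.filter fun i => b i = b' i).sigma
        fun i => (Finset.univ : Finset (Fin (a i)))).image fun p => (b p.1, p) := by
    ext ⟨x, p⟩
    simp only [Finset.mem_inter, mem_blockClique, Finset.mem_image, Finset.mem_sigma,
      Finset.mem_filter, Finset.mem_univ, true_and, and_true, Prod.mk.injEq]
    constructor
    · rintro ⟨h, h'⟩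
      exact ⟨p, h.trans h'.symm, h, rfl⟩
    · rintro ⟨q, hq, h, rfl⟩
      exact ⟨h, hq.symm.trans h⟩
  rw [h, Finset.card_image_of_injective _ fun p q h => (Prod.mk.inj h).2, Finset.card_sigma]
  simp

lemma exists_bFree_of_isSSumFreePartition {r s n : ℕ} (hr : 1 < r)
    (ha : IsSSumFreePartition r s t a) (hn : m * r ≤ n) :
    ∃ G : SimpleGraph (Fin n), BFree G r s ∧ m ^ t ≤ cliqueCount G r := by
  classical
  obtain ⟨_, hpos, hsum, hfree⟩ := ha
  obtain ⟨e⟩ : Nonempty ((Fin m × Σ i, Fin (a i)) ↪ Fin n) :=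
    Function.Embedding.nonempty_of_card_le (by simpa [hsum] using hn)
  refine ⟨(blockGraph m a).map e, ?_, ?_⟩
  · intro S T hS hT
    rw [SimpleGraph.isNClique_map_iff hr] at hS hT
    obtain ⟨S, hS, rfl⟩ := hS
    obtain ⟨T, hT, rfl⟩ := hT
    rw [← hsum] at hS hT
    obtain ⟨b, rfl⟩ := exists_eq_blockClique hpos hS
    obtain ⟨b', rfl⟩ := exists_eq_blockClique hpos hT
    have := hfree (Finset.univ.filter fun i => b i = b' i)
    rw [← card_blockClique_inter, ← Finset.card_map e, Finset.map_inter] at this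
    convert this
  · have hinj : Function.Injective fun b : Fin t → Fin m => (blockClique a b).map e :=
      (Finset.map_injective e).comp (blockClique_injective hpos)
    calc m ^ t = (Set.range fun b : Fin t → Fin m => (blockClique a b).map e).ncard := by
          rw [← Set.image_univ, Set.ncard_image_of_injective _ hinj, Set.ncard_univ]
          simp
      _ ≤ cliqueCount ((blockGraph m a).map e) r := by
        refine Set.ncard_le_ncard ?_ (Set.toFinite _)
        rintro _ ⟨b, rfl⟩
        exact (hsum ▸ isNClique_blockClique b).map

end LowerBound

lemma cliqueCount_le_exB {n r s : ℕ} {G : SimpleGraph (Fin n)} (hG : BFree G r s) :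
    cliqueCount G r ≤ exB n r s := by
  refine le_csSup ⟨Nat.card (Finset (Fin n)), ?_⟩ ⟨G, hG, rfl⟩
  rintro _ ⟨H, _, rfl⟩
  exact Set.ncard_le_card _

lemma exB_le {n r s M : ℕ}
    (h : ∀ G : SimpleGraph (Fin n), BFree G r s → cliqueCount G r ≤ M) : exB n r s ≤ M := by
  refine csSup_le' ?_
  rintro _ ⟨G, hG, rfl⟩
  exact h G hG

/-- For `r ≤ 2s` (with `r > s ≥ 2`), if `β` is the maximum length of an
`s`-sum-free partition of `r`, then `c₁ n^β ≤ ex(n, K_r, B_{r,s}) ≤ c₂ n^s` for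
sufficiently large `n`. -/
theorem stmt11 (r s : ℕ) (hs : 2 ≤ s) (hsr : s < r) (hr : r ≤ 2 * s) (β : ℕ)
    (hβ : IsGreatest {t | ∃ a : Fin t → ℕ, IsSSumFreePartition r s t a} β) :
    ∃ c1 c2 : ℝ, 0 < c1 ∧ 0 < c2 ∧ ∃ N : ℕ, ∀ n ≥ N,
      c1 * (n : ℝ) ^ β ≤ (exB n r s : ℝ) ∧ (exB n r s : ℝ) ≤ c2 * (n : ℝ) ^ s := by
  obtain ⟨a, ha⟩ := hβ.1
  obtain ⟨C, hC⟩ := exists_card_le_of_forall_agreeTypes (ι := Fin r) (s := s)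
    (by simpa using hsr.le) (by simpa using hr)
  have hr0 : (0 : ℝ) < r := by exact_mod_cast (by omega : 0 < r)
  refine ⟨(1 / (2 * r)) ^ β, r ^ r * C + 1, by positivity, by positivity, r, fun n hn => ⟨?_, ?_⟩⟩
  · obtain ⟨G, hG, hcount⟩ := exists_bFree_of_isSSumFreePartition (m := n / r) (n := n)
      (by omega) ha (Nat.div_mul_le_self n r)
    have hm : (1 / (2 * r) : ℝ) * n ≤ (n / r : ℕ) := by
      have h1 : n ≤ 2 * r * (n / r) := by
        have h2 := Nat.div_add_mod n r
        have h3 := Nat.mod_lt n (by omega : 0 < r)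
        have h4 : r * 1 ≤ r * (n / r) :=
          Nat.mul_le_mul_left r ((Nat.one_le_div_iff (by omega)).2 hn)
        rw [mul_assoc]
        omega
      rw [one_div, inv_mul_le_iff₀ (by positivity)]
      exact_mod_cast h1
    calc (1 / (2 * r) : ℝ) ^ β * n ^ β = (1 / (2 * r) * n) ^ β := (mul_pow _ _ _).symm
      _ ≤ ((n / r : ℕ) : ℝ) ^ β := by gcongr
      _ ≤ exB n r s := by exact_mod_cast hcount.trans (cliqueCount_le_exB hG)
  · have h := exB_le fun G hG => cliqueCount_le_of_bFree (by omega) (hC n) hG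
    calc (exB n r s : ℝ) ≤ r ^ r * C * n ^ s := by exact_mod_cast h
      _ ≤ (r ^ r * C + 1) * n ^ s := by
        gcongr
        linarith
end

section
/- For all sufficiently large n, ex(n, K_4, B_{4,2}) ≤ n²/9 + o(n²); i.e., for every ε > 0 there exists N such that every B_{4,2}-free graph on n ≥ N vertices contains at most (1/9 + ε)n² copies of K_4. -/
open SimpleGraph

section Counting

variable {V : Type*} [DecidableEq V] {G H : SimpleGraph V}

/-- If three distinct copies of `K₄` in a `B_{4,2}`-free graph contain a common triple `c`, then no
other copy of `K₄` contains an edge joining the remaining vertex `x` of the first one to `c`. -/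
lemma BFree.eq_insert_of_sunflower (hG : BFree G 4 2) {c U : Finset V} {x y z : V}
    (hc : c.card = 3) (hx : x ∉ c) (hy : y ∉ c) (hz : z ∉ c) (hxy : x ≠ y) (hxz : x ≠ z)
    (hyz : y ≠ z) (hSx : G.IsNClique 4 (insert x c)) (hSy : G.IsNClique 4 (insert y c))
    (hSz : G.IsNClique 4 (insert z c)) (hU : G.IsNClique 4 U) (hxU : x ∈ U)
    (hUc : (U ∩ c).Nonempty) : U = insert x c := by
  have h1 : ∀ t, t ∉ c → t ∈ U → (U ∩ insert t c).card = (U ∩ c).card + 1 := fun t ht htU ↦ by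
    rw [Finset.inter_insert_of_mem htU, Finset.card_insert_of_notMem (by simp [ht])]
  have h2 : ∀ t, t ∉ U → (U ∩ insert t c).card = (U ∩ c).card := fun t htU ↦ by
    rw [Finset.inter_insert_of_notMem htU]
  have hpos := hUc.card_pos
  have hle : (U ∩ c).card ≤ 3 := hc ▸ Finset.card_le_card Finset.inter_subset_right
  have hUx := hG U _ hU hSx
  have hUy := hG U _ hU hSy
  have hUz := hG U _ hU hSz
  rw [h1 x hx hxU] at hUx
  rcases (by lia : (U ∩ c).card = 2 ∨ (U ∩ c).card = 3) with hk | hk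
  · have hyU : y ∈ U := by
      by_contra h
      exact hUy (by rw [h2 y h, hk])
    have hzU : z ∈ U := by
      by_contra h
      exact hUz (by rw [h2 z h, hk])
    have hsub : insert x (insert y (insert z (U ∩ c))) ⊆ U := by
      simp [Finset.insert_subset_iff, hxU, hyU, hzU]
    have hcard := Finset.card_le_card hsub
    rw [Finset.card_insert_of_notMem (by simp [hx, hxy, hxz]),
      Finset.card_insert_of_notMem (by simp [hy, hyz]),
      Finset.card_insert_of_notMem (by simp [hz]), hU.card_eq] at hcard
    lia
  · have hcU : U ∩ c = c :=
      Finset.eq_of_subset_of_card_le Finset.inter_subset_right (by rw [hk, hc])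
    refine (Finset.eq_of_subset_of_card_le (Finset.insert_subset hxU (hcU ▸ Finset.inter_subset_left))
      ?_).symm
    rw [hU.card_eq, hSx.card_eq]

variable [Fintype V] [DecidableRel G.Adj] [DecidableRel H.Adj]

/-- In a `B_{4,2}`-free graph, an edge in at least four copies of `K₄` extends, inside any one of
these copies `S`, to a triple contained in two further copies. -/
lemma BFree.exists_sunflower (hG : BFree G 4 2) {u v : V} (huv : u ≠ v) {S : Finset V}
    (hS : G.IsNClique 4 S) (hu : u ∈ S) (hv : v ∈ S)
    (hF : 4 ≤ ((G.cliqueFinset 4).filter fun T ↦ u ∈ T ∧ v ∈ T).card) :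
    ∃ c x y z, c.card = 3 ∧ x ∉ c ∧ y ∉ c ∧ z ∉ c ∧ x ≠ y ∧ x ≠ z ∧ y ≠ z ∧ S = insert x c ∧
      G.IsNClique 4 (insert y c) ∧ G.IsNClique 4 (insert z c) := by
  set F := (G.cliqueFinset 4).filter fun T ↦ u ∈ T ∧ v ∈ T with hFdef
  have hcard : ((S.erase u).erase v).card = 2 := by
    rw [Finset.card_erase_of_mem (by simp [huv.symm, hv]), Finset.card_erase_of_mem hu,
      hS.card_eq]
  obtain ⟨p, q, hpq, hpqS⟩ := Finset.card_eq_two.1 hcard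
  have hSF : S ∈ F := by simp [hFdef, hS, hu, hv]
  have hcover : F.erase S ⊆ ((F.erase S).filter fun T ↦ p ∈ T) ∪
      ((F.erase S).filter fun T ↦ q ∈ T) := by
    intro T hT
    rw [← Finset.filter_or, Finset.mem_filter]
    refine ⟨hT, ?_⟩
    simp only [hFdef, Finset.mem_erase, Finset.mem_filter, mem_cliqueFinset_iff] at hT
    obtain ⟨hTS, hTc, huT, hvT⟩ := hT
    by_contra! hn
    refine hG S T hS hTc ?_
    have : S ∩ T = {u, v} := by
      ext t
      have := Finset.ext_iff.1 hpqS t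
      simp only [Finset.mem_erase, Finset.mem_insert, Finset.mem_singleton] at this
      simp only [Finset.mem_inter, Finset.mem_insert, Finset.mem_singleton]
      grind
    rw [this, Finset.card_pair huv]
  have hbig : ∃ r ∈ (S.erase u).erase v, 1 < ((F.erase S).filter fun T ↦ r ∈ T).card := by
    have h1 := (Finset.card_le_card hcover).trans (Finset.card_union_le _ _)
    rw [Finset.card_erase_of_mem hSF] at h1
    by_contra! hn
    have hp := hn p (by simp [hpqS])
    have hq := hn q (by simp [hpqS])
    lia
  obtain ⟨r, hr, hrF⟩ := hbig
  obtain ⟨T₁, hT₁, T₂, hT₂, hT⟩ := Finset.one_lt_card.1 hrF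
  simp only [hFdef, Finset.mem_erase, Finset.mem_filter, mem_cliqueFinset_iff] at hr hT₁ hT₂
  obtain ⟨hrv, hru, hrS⟩ := hr
  have hc : ({u, v, r} : Finset V).card = 3 := by
    rw [Finset.card_eq_three]
    exact ⟨u, v, r, huv, hru.symm, hrv.symm, rfl⟩
  have hins : ∀ T : Finset V, G.IsNClique 4 T → u ∈ T → v ∈ T → r ∈ T →
      ∃ x, x ∉ ({u, v, r} : Finset V) ∧ insert x {u, v, r} = T := fun T hT h1 h2 h3 ↦
    Finset.exists_eq_insert_iff.2 ⟨by simp [Finset.insert_subset_iff, h1, h2, h3],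
      by rw [hc, hT.card_eq]⟩
  obtain ⟨x, hx, hxS⟩ := hins S hS hu hv hrS
  obtain ⟨y, hy, hyS⟩ := hins T₁ hT₁.1.2.1 hT₁.1.2.2.1 hT₁.1.2.2.2 hT₁.2
  obtain ⟨z, hz, hzS⟩ := hins T₂ hT₂.1.2.1 hT₂.1.2.2.1 hT₂.1.2.2.2 hT₂.2
  refine ⟨{u, v, r}, x, y, z, hc, hx, hy, hz, ?_, ?_, ?_, hxS.symm, hyS ▸ hT₁.1.2.1,
    hzS ▸ hT₂.1.2.1⟩
  · rintro rfl
    exact hT₁.1.1 (hyS.symm.trans hxS)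
  · rintro rfl
    exact hT₂.1.1 (hzS.symm.trans hxS)
  · rintro rfl
    exact hT (hyS.symm.trans hzS)

/-- The edges of `G` inside `S` that lie in no copy of `K₄` other than `S`. -/
def privateEdges (G : SimpleGraph V) [DecidableRel G.Adj] (S : Finset V) : Finset (Sym2 V) :=
  G.edgeFinset.filter fun e ↦ e ∈ S.sym2 ∧ ∀ T ∈ G.cliqueFinset 4, e ∈ T.sym2 → T = S

lemma BFree.three_le_card_privateEdges (hG : BFree G 4 2) {u v : V} (huv : u ≠ v) {S : Finset V}
    (hS : G.IsNClique 4 S) (hu : u ∈ S) (hv : v ∈ S)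
    (hF : 4 ≤ ((G.cliqueFinset 4).filter fun T ↦ u ∈ T ∧ v ∈ T).card) :
    3 ≤ (privateEdges G S).card := by
  obtain ⟨c, x, y, z, hc, hx, hy, hz, hxy, hxz, hyz, rfl, hSy, hSz⟩ :=
    hG.exists_sunflower huv hS hu hv hF
  have hinj : Function.Injective fun t : V ↦ s(x, t) := fun a b h ↦ Sym2.congr_right.1 h
  rw [← hc, ← Finset.card_image_of_injective c hinj]
  refine Finset.card_le_card fun e he ↦ ?_
  obtain ⟨t, ht, rfl⟩ := Finset.mem_image.1 he
  simp only [privateEdges, Finset.mem_filter, mem_edgeFinset, mem_edgeSet, Finset.mk_mem_sym2_iff,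
    mem_cliqueFinset_iff]
  refine ⟨hS.isClique (by simp) (by simp [ht]) (fun h ↦ hx (h ▸ ht)), ⟨by simp, by simp [ht]⟩, ?_⟩
  rintro U hU ⟨hxU, htU⟩
  exact hG.eq_insert_of_sunflower hc hx hy hz hxy hxz hyz hS hSy hSz hU hxU
    ⟨t, Finset.mem_inter.2 ⟨htU, ht⟩⟩

/-- The number of copies of `K₄` in a `B_{4,2}`-free graph `G`, in terms of the number of edges of
`G` and the number of edges whose deletion leaves a `K₄`-free graph `H`. -/
lemma BFree.three_mul_card_cliqueFinset_le (hG : BFree G 4 2) (hH : H.CliqueFree 4) :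
    3 * (G.cliqueFinset 4).card ≤
      9 * (G.edgeFinset \ H.edgeFinset).card + G.edgeFinset.card := by
  set K := G.cliqueFinset 4
  have hsplit := Finset.card_filter_add_card_filter_not (s := K)
    (fun S ↦ 3 ≤ (privateEdges G S).card)
  have hpriv : 3 * (K.filter fun S ↦ 3 ≤ (privateEdges G S).card).card ≤ G.edgeFinset.card := by
    rw [mul_comm]
    refine (Finset.card_nsmul_le_sum _ (fun S ↦ (privateEdges G S).card) 3
      fun S hS ↦ (Finset.mem_filter.1 hS).2).trans ?_
    rw [← Finset.card_biUnion]
    · refine Finset.card_le_card (Finset.biUnion_subset.2 fun S _ ↦ Finset.filter_subset _ _)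
    · intro S hS T hT hne
      refine Finset.disjoint_left.2 fun e heS heT ↦ hne ?_
      simp only [privateEdges, Finset.mem_filter] at heS heT
      exact heT.2.2 S (Finset.mem_filter.1 hS).1 heS.2.1
  have hrest : (K.filter fun S ↦ ¬ 3 ≤ (privateEdges G S).card).card ≤
      (G.edgeFinset \ H.edgeFinset).card * 3 := by
    refine le_trans (Finset.card_le_card ?_) (Finset.card_biUnion_le_card_mul
      (G.edgeFinset \ H.edgeFinset)
      (fun e ↦ (K.filter fun S ↦ ¬ 3 ≤ (privateEdges G S).card).filter fun S ↦ e ∈ S.sym2) 3 ?_)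
    · intro S hS
      have hSc := mem_cliqueFinset_iff.1 (Finset.mem_filter.1 hS).1
      have hSH : ¬ H.IsClique S := fun h ↦ hH S ⟨h, hSc.card_eq⟩
      simp only [IsClique, Set.Pairwise] at hSH
      push Not at hSH
      obtain ⟨u, hu, v, hv, huv, hadj⟩ := hSH
      refine Finset.mem_biUnion.2 ⟨s(u, v), ?_, Finset.mem_filter.2 ⟨hS, ?_⟩⟩
      · simp [hadj, hSc.isClique hu hv huv]
      · exact Finset.mk_mem_sym2_iff.2 ⟨hu, hv⟩
    · intro e he
      induction e with | _ u v
      have huv : u ≠ v := by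
        have := (Finset.mem_sdiff.1 he).1
        rw [mem_edgeFinset, mem_edgeSet] at this
        exact this.ne
      by_contra! hlt
      obtain ⟨S, hS⟩ := Finset.card_pos.1 (lt_trans (by norm_num) hlt)
      simp only [Finset.mem_filter, Finset.mk_mem_sym2_iff] at hS
      refine hS.1.2.not_ge (hG.three_le_card_privateEdges huv
        (mem_cliqueFinset_iff.1 hS.1.1) hS.2.1 hS.2.2
        (le_trans (Nat.succ_le_of_lt hlt) (Finset.card_le_card fun T hT ↦ ?_)))
      simp only [Finset.mem_filter, Finset.mk_mem_sym2_iff] at hT ⊢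
      exact ⟨hT.1.1, hT.2⟩
  lia

end Counting

section Removal

variable {V : Type*} {G : SimpleGraph V}

/-- Two adjacent vertices `a`, `b` with two disjoint edges in their common neighbourhood span two
copies of `K₄` that share exactly `a` and `b`. -/
lemma not_bFree_of_adj [DecidableEq V] {a b c d c' d' : V} (hab : G.Adj a b)
    (hac : G.Adj a c) (hbc : G.Adj b c) (had : G.Adj a d) (hbd : G.Adj b d) (hcd : G.Adj c d)
    (hac' : G.Adj a c') (hbc' : G.Adj b c') (had' : G.Adj a d') (hbd' : G.Adj b d')
    (hcd' : G.Adj c' d') (h₁ : c ≠ c') (h₂ : c ≠ d') (h₃ : d ≠ c') (h₄ : d ≠ d') :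
    ¬ BFree G 4 2 := by
  intro hG
  have hclique : ∀ {x y : V}, G.Adj a x → G.Adj b x → G.Adj a y → G.Adj b y → G.Adj x y →
      G.IsNClique 4 {a, b, x, y} := fun hax hbx hay hby hxy ↦
    (is3Clique_triple_iff.2 ⟨hbx, hby, hxy⟩).insert (by simp [hab, hax, hay])
  refine hG _ _ (hclique hac hbc had hbd hcd) (hclique hac' hbc' had' hbd' hcd') ?_
  have : ({c, d} : Finset V) ∩ {a, b, c', d'} = ∅ := by
    ext t
    simp only [Finset.mem_inter, Finset.mem_insert, Finset.mem_singleton, Finset.notMem_empty,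
      iff_false]
    rintro ⟨rfl | rfl, rfl | rfl | rfl | rfl⟩ <;> simp_all
  rw [Finset.insert_inter_of_mem (by simp), Finset.insert_inter_of_mem (by simp), this]
  exact Finset.card_pair hab.ne

variable [DecidableRel G.Adj]

/-- In a uniform dense pair `(A, B)`, few vertices of `A` have few neighbours in a given large
subset of `B`. -/
lemma card_filter_low_degree_lt {A B B' : Finset V} {η δ : ℝ} (hηδ : η ≤ δ)
    (hU : G.IsUniform η A B) (hd : 2 * δ ≤ G.edgeDensity A B) (hB' : B' ⊆ B)
    (hcard : (B.card : ℝ) * η ≤ B'.card) :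
    ((A.filter fun a ↦ ((B'.filter fun b ↦ G.Adj a b).card : ℝ) < δ * B'.card).card : ℝ) <
      A.card * η := by
  classical
  set L := A.filter fun a ↦ ((B'.filter fun b ↦ G.Adj a b).card : ℝ) < δ * B'.card
  by_contra! hle
  have h1 := hU (Finset.filter_subset _ _ : L ⊆ A) hB' hle hcard
  have hδ : 0 < δ := hU.pos.trans_le hηδ
  have h2 : (G.edgeDensity L B' : ℝ) ≤ δ := by
    rw [edgeDensity_def]
    push_cast
    refine div_le_of_le_mul₀ (by positivity) hδ.le ?_
    have : (G.interedges L B').card = ∑ a ∈ L, (B'.filter fun b ↦ G.Adj a b).card := by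
      rw [interedges, Rel.interedges_eq_biUnion, Finset.card_biUnion]
      · simp
      · intro a _ b _ hab
        simp only [Function.onFun, Finset.disjoint_left, Finset.mem_map]
        rintro _ ⟨t, -, rfl⟩ ⟨t', -, h⟩
        simp only [Function.Embedding.coeFn_mk, Prod.mk.injEq] at h
        exact hab h.1.symm
    rw [this]
    push_cast
    refine (Finset.sum_le_card_nsmul _ _ (δ * B'.card) fun a ha ↦
      (Finset.mem_filter.1 ha).2.le).trans_eq ?_
    rw [nsmul_eq_mul]
    ring
  rw [abs_lt] at h1
  linarith

/-- Large uniform dense pairs between four sets yield two copies of `K₄` sharing two vertices. -/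
lemma not_bFree_of_isUniform [DecidableEq V] {A B C D : Finset V} {δ : ℝ} (hδ : 0 < δ)
    (hδ1 : δ ≤ 1 / 2) (hCD : Disjoint C D)
    (hCsz : 2 ≤ δ ^ 3 * C.card) (hDsz : 2 ≤ δ ^ 3 * D.card)
    (uAB : G.IsUniform (δ ^ 2 / 2) A B) (dAB : 2 * δ ≤ G.edgeDensity A B)
    (uAC : G.IsUniform (δ ^ 2 / 2) A C) (dAC : 2 * δ ≤ G.edgeDensity A C)
    (uAD : G.IsUniform (δ ^ 2 / 2) A D) (dAD : 2 * δ ≤ G.edgeDensity A D)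
    (uBC : G.IsUniform (δ ^ 2 / 2) B C) (dBC : 2 * δ ≤ G.edgeDensity B C)
    (uBD : G.IsUniform (δ ^ 2 / 2) B D) (dBD : 2 * δ ≤ G.edgeDensity B D)
    (uCD : G.IsUniform (δ ^ 2 / 2) C D) (dCD : 2 * δ ≤ G.edgeDensity C D) :
    ¬ BFree G 4 2 := by
  intro hG
  have hη : δ ^ 2 / 2 ≤ δ := by nlinarith
  have hsq : ∀ X : Finset V, δ ^ 2 * X.card ≤ δ / 2 * X.card := fun X ↦ by
    gcongr
    nlinarith
  have hhalf : ∀ X : Finset V, δ * X.card ≤ 1 / 2 * X.card := fun X ↦ by gcongr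
  have hself : ∀ X : Finset V, (X.card : ℝ) * (δ ^ 2 / 2) ≤ X.card := fun X ↦
    by linarith [hsq X, hhalf X, X.card.cast_nonneg (α := ℝ)]
  have hdeg : ∀ {X Y : Finset V} {x : V}, x ∈ X →
      x ∉ X.filter (fun a ↦ ((Y.filter fun b ↦ G.Adj a b).card : ℝ) < δ * Y.card) →
      δ * Y.card ≤ (Y.filter fun b ↦ G.Adj x b).card := fun {X Y x} hx hn ↦ by
    simpa [hx] using hn
  have hcast : ∀ X Y : Finset V, ((X ∪ Y).card : ℝ) ≤ X.card + Y.card := fun X Y ↦ by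
    exact_mod_cast Finset.card_union_le X Y
  have lAB := card_filter_low_degree_lt hη uAB dAB subset_rfl (hself B)
  have lAC := card_filter_low_degree_lt hη uAC dAC subset_rfl (hself C)
  have lAD := card_filter_low_degree_lt hη uAD dAD subset_rfl (hself D)
  obtain ⟨a, haA, ha⟩ := Finset.exists_mem_notMem_of_card_lt_card (s := _ ∪ _ ∪ _) (t := A)
    (by
      rw [← Nat.cast_lt (α := ℝ)]
      refine (hcast _ _).trans_lt ((add_le_add_left (hcast _ _) _).trans_lt
        ((add_lt_add (add_lt_add lAB lAC) lAD).trans_le ?_))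
      linarith [hsq A, hhalf A])
  simp only [Finset.mem_union, not_or] at ha
  have aB := hdeg haA ha.1.1
  have aC := hdeg haA ha.1.2
  have aD := hdeg haA ha.2
  set B₁ := B.filter fun b ↦ G.Adj a b
  set C₁ := C.filter fun b ↦ G.Adj a b
  set D₁ := D.filter fun b ↦ G.Adj a b
  have lBC := card_filter_low_degree_lt hη uBC dBC (Finset.filter_subset _ C : C₁ ⊆ C)
    (le_trans (by linarith [hsq C, show 0 ≤ δ * (C.card : ℝ) by positivity]) aC)
  have lBD := card_filter_low_degree_lt hη uBD dBD (Finset.filter_subset _ D : D₁ ⊆ D)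
    (le_trans (by linarith [hsq D, show 0 ≤ δ * (D.card : ℝ) by positivity]) aD)
  obtain ⟨b, hbB₁, hb⟩ := Finset.exists_mem_notMem_of_card_lt_card (s := _ ∪ _) (t := B₁)
    (by
      rw [← Nat.cast_lt (α := ℝ)]
      refine (hcast _ _).trans_lt ((add_lt_add lBC lBD).trans_le (le_trans ?_ aB))
      linarith [hsq B])
  simp only [Finset.mem_union, not_or] at hb
  obtain ⟨hbB, hab⟩ := Finset.mem_filter.1 hbB₁
  have bC := hdeg hbB hb.1
  have bD := hdeg hbB hb.2
  set C₂ := C₁.filter fun x ↦ G.Adj b x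
  set D₂ := D₁.filter fun x ↦ G.Adj b x
  have hC₂ : δ ^ 2 * C.card ≤ C₂.card := by
    linarith [mul_le_mul_of_nonneg_left aC hδ.le]
  have hD₂ : δ ^ 2 * D.card ≤ D₂.card := by
    linarith [mul_le_mul_of_nonneg_left aD hδ.le]
  have lCD := card_filter_low_degree_lt hη uCD dCD
    ((Finset.filter_subset _ _).trans (Finset.filter_subset _ D) : D₂ ⊆ D)
    (le_trans (by linarith [show 0 ≤ δ ^ 2 * (D.card : ℝ) by positivity]) hD₂)
  set L := C.filter fun x ↦ ((D₂.filter fun y ↦ G.Adj x y).card : ℝ) < δ * D₂.card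
  have hgood : 1 < (C₂ \ L).card := by
    have h1 : (C₂.card : ℝ) ≤ (C₂ \ L).card + L.card := by
      exact_mod_cast Finset.card_le_card_sdiff_add_card
    have h2 : (1 : ℝ) < (C₂ \ L).card := by
      have : δ ^ 3 * C.card ≤ δ ^ 2 / 2 * C.card := by
        linarith [mul_le_mul_of_nonneg_left (hsq C) hδ.le]
      linarith
    exact_mod_cast h2
  have hnbr : ∀ x ∈ C₂ \ L, G.Adj a x ∧ G.Adj b x ∧ x ∈ C ∧
      1 < (D₂.filter fun y ↦ G.Adj x y).card := by
    intro x hx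
    obtain ⟨hx₂, hxL⟩ := Finset.mem_sdiff.1 hx
    obtain ⟨hx₁, hbx⟩ := Finset.mem_filter.1 hx₂
    obtain ⟨hxC, hax⟩ := Finset.mem_filter.1 hx₁
    have hxD := hdeg hxC hxL
    refine ⟨hax, hbx, hxC, ?_⟩
    have : (1 : ℝ) < (D₂.filter fun y ↦ G.Adj x y).card := by
      linarith [mul_le_mul_of_nonneg_left hD₂ hδ.le]
    exact_mod_cast this
  obtain ⟨c, hc, c', hc', hcc⟩ := Finset.one_lt_card.1 hgood
  obtain ⟨hac, hbc, hcC, hcD⟩ := hnbr c hc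
  obtain ⟨hac', hbc', hcC', hcD'⟩ := hnbr c' hc'
  obtain ⟨d, hd⟩ := Finset.card_pos.1 (zero_lt_one.trans hcD)
  obtain ⟨d', hd', hdd⟩ := Finset.exists_mem_ne hcD' d
  simp only [D₂, D₁, Finset.mem_filter] at hd hd'
  have hne : ∀ {x y : V}, x ∈ C → y ∈ D → x ≠ y := fun hx hy h ↦
    Finset.disjoint_left.1 hCD hx (h ▸ hy)
  exact not_bFree_of_adj hab hac hbc hd.1.1.2 hd.1.2 hd.2 hac' hbc' hd'.1.1.2 hd'.1.2 hd'.2 hcc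
    (hne hcC hd'.1.1.1) (hne hcC' hd.1.1.1).symm hdd.symm hG

/-- Passing to the regularity reduced graph loses few edges. -/
lemma card_edgeFinset_sdiff_regularityReduced_le [Fintype V] [DecidableEq V] [Nonempty V]
    {P : Finpartition (Finset.univ : Finset V)} {η d γ : ℝ} (hη : 0 < η) (hd : 0 ≤ d) (hγ : 0 < γ)
    (hP : P.IsEquipartition) (hPη : P.IsUniform G η) (hPγ : 4 / γ ≤ P.parts.card) :
    2 * ((G.edgeFinset \ (G.regularityReduced P η d).edgeFinset).card : ℝ) ≤
      (4 * η + γ / 2 + 4 * d) * Fintype.card V ^ 2 := by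
  set G' := G.regularityReduced P η d
  have hsub : Finset.univ.filter (fun x : V × V ↦ (G \ G').Adj x.1 x.2) ⊆
      (P.nonUniforms G η).biUnion (fun (U, W) ↦ U ×ˢ W) ∪ P.parts.biUnion Finset.offDiag ∪
        (P.sparsePairs G d).biUnion fun (U, W) ↦ G.interedges U W := by
    rintro ⟨x, y⟩ hxy
    simp only [Finset.mem_filter, Finset.mem_univ, true_and, sdiff_adj] at hxy
    obtain ⟨hG, hG'⟩ := hxy
    simp only [Finset.mem_union, Finset.mem_biUnion, Prod.exists, Finset.mem_product,
      Finset.mem_offDiag, Finpartition.mk_mem_nonUniforms, Finpartition.mk_mem_sparsePairs,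
      mem_interedges_iff]
    obtain ⟨U, hU, hx⟩ := P.exists_mem (Finset.mem_univ x)
    obtain ⟨W, hW, hy⟩ := P.exists_mem (Finset.mem_univ y)
    by_cases hUW : U = W
    · subst hUW
      exact Or.inl (Or.inr ⟨U, hU, hx, hy, hG.ne⟩)
    by_cases hu : G.IsUniform η U W
    · refine Or.inr ⟨U, W, ⟨hU, hW, hUW, ?_⟩, hx, hy, hG⟩
      by_contra! hden
      exact hG' ⟨hG, U, hU, W, hW, hx, hy, hUW, hu, hden⟩
    · exact Or.inl (Or.inl ⟨U, W, ⟨hU, hW, hUW, hu⟩, hx, hy⟩)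
  have hcard : 2 * (G.edgeFinset \ G'.edgeFinset).card =
      (Finset.univ.filter fun x : V × V ↦ (G \ G').Adj x.1 x.2).card := by
    rw [← edgeFinset_sdiff]
    convert two_mul_card_edgeFinset (G \ G')
  have h1 := (hP.sum_nonUniforms_lt Finset.univ_nonempty hη hPη).le
  have h2 := hP.card_biUnion_offDiag_le hγ hPγ
  have h3 := hP.card_interedges_sparsePairs_le (G := G) hd
  rw [Finset.card_univ] at h1 h2 h3
  have h4 := (Finset.card_le_card hsub).trans ((Finset.card_union_le _ _).trans
    (Nat.add_le_add_right (Finset.card_union_le _ _) _))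
  rw [← hcard, ← Nat.cast_le (α := ℝ)] at h4
  push_cast at h4
  linarith

end Removal

/-- **Turán's theorem** for `K₄`, with the bound `n² / 3`. -/
lemma three_mul_card_edgeFinset_le {V : Type*} [Fintype V] {H : SimpleGraph V}
    [DecidableRel H.Adj] (hH : H.CliqueFree 4) :
    3 * H.edgeFinset.card ≤ Fintype.card V ^ 2 := by
  have h := CliqueFree.card_edgeFinset_le (r := 3) hH
  simp only at h
  have hn := Nat.mod_lt (Fintype.card V) (by norm_num : 3 > 0)
  have hsq : (Fintype.card V % 3) ^ 2 ≤ Fintype.card V ^ 2 :=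
    Nat.pow_le_pow_left (Nat.mod_le _ _) 2
  generalize Fintype.card V ^ 2 = m at *
  interval_cases hr : Fintype.card V % 3 <;> norm_num [Nat.choose] at h hsq <;> lia

/-- For every `ε > 0` there exists `N` such that every `B_{4,2}`-free graph on
`n ≥ N` vertices contains at most `(1/9 + ε) n²` copies of `K₄`. -/
theorem stmt13 :
    ∀ ε : ℝ, 0 < ε → ∃ N : ℕ, ∀ n ≥ N, ∀ G : SimpleGraph (Fin n),
      BFree G 4 2 → (cliqueCount G 4 : ℝ) ≤ (1 / 9 + ε) * (n : ℝ) ^ 2 := by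
  classical
  intro ε hε
  set δ : ℝ := min (ε / 24) (1 / 2)
  have hδ : 0 < δ := by positivity
  have hδε : δ ≤ ε / 24 := min_le_left _ _
  have hδ1 : δ ≤ 1 / 2 := min_le_right _ _
  set l := ⌈4 / δ⌉₊
  set K := SzemerediRegularity.bound (δ ^ 2 / 2) l
  set M := ⌈2 / δ ^ 3⌉₊
  have hK : 0 < K := SzemerediRegularity.bound_pos _ _
  refine ⟨l + K * M + 1, fun n hn G hG ↦ ?_⟩
  have : Nonempty (Fin n) := ⟨⟨0, by lia⟩⟩
  obtain ⟨P, hP, hlP, hPK, hPu⟩ := szemeredi_regularity G (by positivity : 0 < δ ^ 2 / 2)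
    (by rw [Fintype.card_fin]; lia : l ≤ Fintype.card (Fin n))
  have hsize : ∀ X ∈ P.parts, 2 ≤ δ ^ 3 * (X.card : ℝ) := by
    intro X hX
    have h1 : M ≤ X.card := by
      refine le_trans ?_ (hP.average_le_card_part hX)
      rw [Finset.card_univ, Fintype.card_fin,
        Nat.le_div_iff_mul_le (Finset.card_pos.2 ⟨X, hX⟩)]
      calc M * P.parts.card ≤ M * K := Nat.mul_le_mul_left _ hPK
        _ ≤ n := by lia
    have h2 : 2 / δ ^ 3 ≤ (X.card : ℝ) := (Nat.le_ceil _).trans (Nat.cast_le.2 h1)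
    rwa [div_le_iff₀' (by positivity)] at h2
  set H := G.regularityReduced P (δ ^ 2 / 2) (2 * δ)
  have hpart : ∀ {x y A B}, A ∈ P.parts → B ∈ P.parts → x ∈ A → y ∈ B → H.Adj x y →
      A ≠ B ∧ G.IsUniform (δ ^ 2 / 2) A B ∧ 2 * δ ≤ G.edgeDensity A B := by
    rintro x y A B hA hB hx hy ⟨-, A', hA', B', hB', hx', hy', h⟩
    rwa [P.eq_of_mem_parts hA hA' hx hx', P.eq_of_mem_parts hB hB' hy hy']
  have hH : H.CliqueFree 4 := by
    intro S hS
    obtain ⟨a, b, c, d, hab, hac, had, hbc, hbd, hcd, rfl⟩ := Finset.card_eq_four.1 hS.card_eq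
    obtain ⟨A, hA, haA⟩ := P.exists_mem (Finset.mem_univ a)
    obtain ⟨B, hB, hbB⟩ := P.exists_mem (Finset.mem_univ b)
    obtain ⟨C, hC, hcC⟩ := P.exists_mem (Finset.mem_univ c)
    obtain ⟨D, hD, hdD⟩ := P.exists_mem (Finset.mem_univ d)
    have hAB := hpart hA hB haA hbB (hS.isClique (by simp) (by simp) hab)
    have hAC := hpart hA hC haA hcC (hS.isClique (by simp) (by simp) hac)
    have hAD := hpart hA hD haA hdD (hS.isClique (by simp) (by simp) had)
    have hBC := hpart hB hC hbB hcC (hS.isClique (by simp) (by simp) hbc)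
    have hBD := hpart hB hD hbB hdD (hS.isClique (by simp) (by simp) hbd)
    have hCD := hpart hC hD hcC hdD (hS.isClique (by simp) (by simp) hcd)
    exact not_bFree_of_isUniform hδ hδ1 (P.disjoint hC hD hCD.1) (hsize C hC)
      (hsize D hD) hAB.2.1 hAB.2.2 hAC.2.1 hAC.2.2 hAD.2.1 hAD.2.2 hBC.2.1 hBC.2.2
      hBD.2.1 hBD.2.2 hCD.2.1 hCD.2.2 hG
  have hcount := hG.three_mul_card_cliqueFinset_le hH
  have hturan := three_mul_card_edgeFinset_le hH
  have hremoved : 2 * ((G.edgeFinset \ H.edgeFinset).card : ℝ) ≤ _ :=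
    card_edgeFinset_sdiff_regularityReduced_le (by positivity : 0 < δ ^ 2 / 2)
    (by positivity : 0 ≤ 2 * δ) hδ hP hPu ((Nat.le_ceil _).trans (Nat.cast_le.2 hlP))
  have hedges : G.edgeFinset.card ≤ (G.edgeFinset \ H.edgeFinset).card + H.edgeFinset.card :=
    Finset.card_le_card_sdiff_add_card
  rw [Fintype.card_fin] at hturan hremoved
  have hcc : cliqueCount G 4 = (G.cliqueFinset 4).card := by
    rw [cliqueCount, ← Set.ncard_coe_finset, coe_cliqueFinset]
    rfl
  rw [hcc]
  have hcount' : (3 * (G.cliqueFinset 4).card : ℝ) ≤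
      9 * (G.edgeFinset \ H.edgeFinset).card + G.edgeFinset.card := by exact_mod_cast hcount
  have hturan' : (3 * H.edgeFinset.card : ℝ) ≤ (n : ℝ) ^ 2 := by exact_mod_cast hturan
  have hedges' : (G.edgeFinset.card : ℝ) ≤
      (G.edgeFinset \ H.edgeFinset).card + H.edgeFinset.card := by exact_mod_cast hedges
  have hloss : (4 * (δ ^ 2 / 2) + δ / 2 + 4 * (2 * δ)) * (n : ℝ) ^ 2 ≤
      10 * (ε / 24) * (n : ℝ) ^ 2 := by
    gcongr
    nlinarith
  have hεn : 0 ≤ ε * (n : ℝ) ^ 2 := by positivity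
  linarith
end

section
/- Let r, s be positive integers with r ≥ 2s+3 and let F be an r-element set. Suppose 𝓘 ⊆ 2^F \ {F} is closed under pairwise intersection, no member of 𝓘 has cardinality s, and every (r−s−2)-element subset of F is contained in some member of 𝓘. Then there exists an (s+1)-element subset A of F such that every set I with A ⊆ I ⊊ F belongs to 𝓘. -/
/-- If every incidence `a ∈ A y` satisfies `deg a ≤ |A y|` and no `A y` is empty, then there are
at most as many sets as points. -/
theorem card_le_card_of_degree_le {β γ : Type*} [DecidableEq γ] (Y : Finset β) (R : Finset γ)
    (A : β → Finset γ) (hAR : ∀ y ∈ Y, A y ⊆ R) (hne : ∀ y ∈ Y, (A y).Nonempty)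
    (hdeg : ∀ y ∈ Y, ∀ a ∈ A y, (Y.filter (a ∈ A ·)).card ≤ (A y).card) :
    Y.card ≤ R.card := by
  have key : (Y.card : ℚ) ≤ R.card := by
    calc (Y.card : ℚ) = ∑ y ∈ Y, ∑ a ∈ R with a ∈ A y, ((A y).card : ℚ)⁻¹ := by
          rw [Finset.card_eq_sum_ones, Nat.cast_sum]
          refine Finset.sum_congr rfl fun y hy => ?_
          have h : (R.filter (· ∈ A y)) = A y := by
            ext a
            simpa using fun ha => hAR y hy ha
          have h0 : ((A y).card : ℚ) ≠ 0 := by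
            exact_mod_cast (Finset.card_pos.2 (hne y hy)).ne'
          rw [h, Finset.sum_const, nsmul_eq_mul, mul_inv_cancel₀ h0, Nat.cast_one]
      _ = ∑ a ∈ R, ∑ y ∈ Y with a ∈ A y, ((A y).card : ℚ)⁻¹ := by
          simp only [Finset.sum_filter]
          exact Finset.sum_comm
      _ ≤ ∑ a ∈ R, 1 := by
          refine Finset.sum_le_sum fun a _ => ?_
          have h : ∀ y ∈ Y.filter (a ∈ A ·),
              ((A y).card : ℚ)⁻¹ ≤ ((Y.filter (a ∈ A ·)).card : ℚ)⁻¹ := by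
            intro y hy
            have hpos : 0 < (Y.filter (a ∈ A ·)).card := Finset.card_pos.2 ⟨y, hy⟩
            rw [Finset.mem_filter] at hy
            have hle := hdeg y hy.1 a hy.2
            gcongr
          refine (Finset.sum_le_sum h).trans ?_
          rw [Finset.sum_const, nsmul_eq_mul]
          exact mul_inv_le_one
      _ = R.card := by simp
  exact_mod_cast key

/-- Given a family `P` of sets indexed by `Y`, every `t` with `|R| < t ≤ |Y|` is of the form
`|D| + |(⋃ y ∈ D, P y) ∩ R|` for some `D ⊆ Y`. -/
theorem exists_card_add_card_biUnion_inter_eq {β γ : Type*} [DecidableEq β] [DecidableEq γ]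
    (P : β → Finset γ) (Y : Finset β) (R : Finset γ) (t : ℕ) (hRt : R.card < t)
    (htY : t ≤ Y.card) : ∃ D ⊆ Y, D.card + (D.biUnion P ∩ R).card = t := by
  induction hn : Y.card using Nat.strong_induction_on generalizing Y R t with
  | _ n ih =>
  subst hn
  have card_insert {y : β} {D : Finset β} (hy : y ∉ D) :
      (insert y D).card + ((insert y D).biUnion P ∩ R).card =
        1 + (R ∩ P y).card + (D.card + (D.biUnion P ∩ (R \ P y)).card) := by
    have h : (insert y D).biUnion P ∩ R = (R ∩ P y) ∪ (D.biUnion P ∩ (R \ P y)) := by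
      ext a
      simp only [Finset.biUnion_insert, Finset.mem_inter, Finset.mem_union, Finset.mem_sdiff]
      tauto
    rw [Finset.card_insert_of_notMem hy, h, Finset.card_union_of_disjoint]
    · ring
    · rw [Finset.disjoint_left]
      simp only [Finset.mem_inter, Finset.mem_sdiff]
      tauto
  have card_split (y : β) : (R ∩ P y).card + (R \ P y).card = R.card :=
    Finset.card_inter_add_card_sdiff R (P y)
  obtain hlt | rfl := (Nat.succ_le_of_lt hRt).lt_or_eq
  · obtain ⟨y, hy⟩ : Y.Nonempty := Finset.card_pos.1 (by omega)
    have hYe := Finset.card_erase_add_one hy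
    have := card_split y
    obtain ⟨D, hD, hDt⟩ := ih _ (by omega) (Y.erase y) (R \ P y) (t - 1 - (R ∩ P y).card)
      (by omega) (by omega) rfl
    refine ⟨insert y D, Finset.insert_subset hy (hD.trans (Finset.erase_subset _ _)), ?_⟩
    rw [card_insert fun h => Finset.notMem_erase y Y (hD h)]
    omega
  · by_contra! hno
    refine absurd (card_le_card_of_degree_le Y R (R \ P ·) (fun _ _ => Finset.sdiff_subset)
      ?_ ?_) (by omega)
    · intro y hy
      by_contra h
      rw [Finset.not_nonempty_iff_eq_empty, Finset.sdiff_eq_empty_iff_subset] at h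
      refine hno {y} (by simpa using hy) ?_
      rw [Finset.singleton_biUnion, Finset.inter_eq_right.2 h, Finset.card_singleton]
      omega
    · intro y hy a ha
      by_contra! hlt
      have hyY : y ∈ Y.filter (a ∈ R \ P ·) := Finset.mem_filter.2 ⟨hy, ha⟩
      have hYe := Finset.card_erase_add_one hyY
      have hle := Finset.card_filter_le Y (a ∈ R \ P ·)
      have hRe := Finset.card_erase_add_one ha
      obtain ⟨D, hD, hDt⟩ := ih _ (by omega) ((Y.filter (a ∈ R \ P ·)).erase y)
        ((R \ P y).erase a) (R \ P y).card (by omega) (by omega) rfl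
      have haD : D.biUnion P ∩ (R \ P y) = D.biUnion P ∩ (R \ P y).erase a := by
        have ha' : a ∉ D.biUnion P ∩ (R \ P y) := by
          simp only [Finset.mem_inter, Finset.mem_biUnion, not_and, forall_exists_index, and_imp]
          intro z hz haz
          have := (Finset.mem_filter.1 (Finset.mem_of_mem_erase (hD hz))).2
          exact absurd haz (Finset.mem_sdiff.1 this).2
        rw [Finset.inter_erase, Finset.erase_eq_of_notMem ha']
      refine hno (insert y D) (Finset.insert_subset hy fun z hz => ?_) ?_
      · exact (Finset.mem_filter.1 (Finset.mem_of_mem_erase (hD hz))).1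
      · rw [card_insert fun h => Finset.notMem_erase _ _ (hD h), haD, hDt]
        have := card_split y
        omega

/-- A family of finite sets closed under pairwise unions is closed under nonempty finite unions. -/
theorem biUnion_mem_of_union_mem {α β : Type*} [DecidableEq α] [DecidableEq β]
    {G : Set (Finset α)} (hG : ∀ A ∈ G, ∀ B ∈ G, A ∪ B ∈ G) {D : Finset β} (hD : D.Nonempty)
    {f : β → Finset α} (hf : ∀ y ∈ D, f y ∈ G) : D.biUnion f ∈ G := by
  induction hD using Finset.Nonempty.cons_induction with
  | singleton a => simpa using hf
  | cons a D ha hD ih =>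
    rw [Finset.cons_eq_insert, Finset.biUnion_insert]
    exact hG _ (hf a (by simp)) _ (ih fun y hy => hf y (by simp [hy]))

/-- Suppose `G` is union-closed without members of size `t`, and `insert y (P y) ∈ G` with
`P y ⊆ R` for each `y ∈ D`, where `D` is nonempty and disjoint from `R`. Then
`|D| + |⋃ y ∈ D, P y| ≠ t`. -/
theorem card_add_card_biUnion_ne {α : Type*} [DecidableEq α] {G : Set (Finset α)}
    (hG : ∀ A ∈ G, ∀ B ∈ G, A ∪ B ∈ G) {t : ℕ} (ht : ∀ A ∈ G, A.card ≠ t) {R D : Finset α}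
    {P : α → Finset α} (hD : D.Nonempty) (hDR : Disjoint D R) (hPR : ∀ y ∈ D, P y ⊆ R)
    (hP : ∀ y ∈ D, insert y (P y) ∈ G) : D.card + (D.biUnion P).card ≠ t := by
  have h : D.biUnion (fun y => insert y (P y)) = D ∪ D.biUnion P := by
    ext a
    simp only [Finset.mem_biUnion, Finset.mem_insert, Finset.mem_union]
    grind
  rw [← Finset.card_union_of_disjoint (hDR.mono_right (Finset.biUnion_subset.2 hPR)), ← h]
  exact ht _ (biUnion_mem_of_union_mem hG hD hP)


/-- Frankl–Füredi, Lemma 5.5: let `r ≥ 2s+3`, `F` an `r`-element set, and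
`𝓘 ⊆ 2^F \ {F}` an intersection-closed family with no member of cardinality `s`
covering all `(r−s−2)`-element subsets of `F`. Then there is an `(s+1)`-element
subset `A` of `F` with `{I | A ⊆ I ⊊ F} ⊆ 𝓘`. -/
theorem stmt17 {α : Type*} [DecidableEq α] (r s : ℕ) (hs : 0 < s) (hr : 2 * s + 3 ≤ r)
    (F : Finset α) (hF : F.card = r) (I : Set (Finset α))
    (hsub : ∀ J ∈ I, J ⊆ F ∧ J ≠ F)
    (hclosed : ∀ J ∈ I, ∀ J' ∈ I, J ∩ J' ∈ I)
    (hcard : ∀ J ∈ I, J.card ≠ s)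
    (hcover : ∀ T ⊆ F, T.card = r - s - 2 → ∃ J ∈ I, T ⊆ J) :
    ∃ A ⊆ F, A.card = s + 1 ∧ ∀ J : Finset α, A ⊆ J → J ⊂ F → J ∈ I := by
  classical
  set G : Set (Finset α) := {A | A ⊆ F ∧ F \ A ∈ I}
  have hG : ∀ A ∈ G, ∀ B ∈ G, A ∪ B ∈ G := fun A hA B hB =>
    ⟨Finset.union_subset hA.1 hB.1, by
      rw [Finset.sdiff_union_distrib]
      exact hclosed _ hA.2 _ hB.2⟩
  have hGne : ∀ A ∈ G, A.Nonempty := fun A hA => by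
    rw [Finset.nonempty_iff_ne_empty]
    rintro rfl
    exact (hsub _ hA.2).2 Finset.sdiff_empty
  have hGcard : ∀ A ∈ G, A.card ≠ r - s := fun A hA h => by
    refine hcard _ hA.2 ?_
    rw [Finset.card_sdiff_of_subset hA.1]
    omega
  have hGcover : ∀ T ⊆ F, T.card = s + 2 → ∃ A ∈ G, A ⊆ T := fun T hT hTc => by
    obtain ⟨J, hJ, hTJ⟩ := hcover (F \ T) Finset.sdiff_subset (by
      rw [Finset.card_sdiff_of_subset hT]; omega)
    refine ⟨F \ J, ⟨Finset.sdiff_subset, ?_⟩, sdiff_le_comm.1 hTJ⟩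
    rwa [Finset.sdiff_sdiff_eq_self (hsub J hJ).1]
  obtain ⟨R, hR⟩ := (F.powerset.filter fun R => ∀ A ∈ G, ¬ A ⊆ R).exists_maximal
    ⟨∅, by simpa using fun A hA => (hGne A hA).ne_empty⟩
  obtain ⟨hRF, hRG⟩ : R ⊆ F ∧ ∀ A ∈ G, ¬ A ⊆ R := by simpa using hR.prop
  have hRs : R.card ≤ s + 1 := by
    by_contra! h
    obtain ⟨T, hTR, hT⟩ := Finset.exists_subset_card_eq (Nat.succ_le_of_lt h)
    obtain ⟨A, hA, hAT⟩ := hGcover T (hTR.trans hRF) hT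
    exact hRG A hA (hAT.trans hTR)
  have hex : ∀ y ∈ F \ R, ∃ Q ⊆ R, insert y Q ∈ G := fun y hy => by
    rw [Finset.mem_sdiff] at hy
    by_contra! hno
    refine hy.2 (hR.le_of_ge (y := insert y R) ?_ (Finset.subset_insert y R)
      (Finset.mem_insert_self y R))
    simp only [Finset.mem_filter, Finset.mem_powerset]
    refine ⟨Finset.insert_subset hy.1 hRF, fun A hA hAR => ?_⟩
    by_cases hyA : y ∈ A
    · exact hno (A.erase y) (Finset.subset_insert_iff.1 hAR) (by rwa [Finset.insert_erase hyA])
    · exact hRG A hA ((Finset.subset_insert_iff_of_notMem hyA).1 hAR)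
  choose! P hPR hP using hex
  have hne : ∀ D ⊆ F \ R, D.Nonempty → D.card + (D.biUnion P).card ≠ r - s := fun D hD hDne =>
    card_add_card_biUnion_ne hG hGcard hDne (Finset.sdiff_disjoint.mono_left hD)
      (fun y hy => hPR y (hD hy)) fun y hy => hP y (hD hy)
  have hFR : (F \ R).card = r - R.card := by rw [Finset.card_sdiff_of_subset hRF, hF]
  have hPD : ∀ D ⊆ F \ R, D.biUnion P ⊆ R := fun D hD =>
    Finset.biUnion_subset.2 fun y hy => hPR y (hD hy)
  obtain hlt | heq := hRs.lt_or_eq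
  · obtain ⟨D, hD, hDc⟩ := exists_card_add_card_biUnion_inter_eq P (F \ R) R (r - s)
      (by omega) (by omega)
    rw [Finset.inter_eq_left.2 (hPD D hD)] at hDc
    refine absurd hDc (hne D hD (Finset.nonempty_iff_ne_empty.2 ?_))
    rintro rfl
    simp at hDc
    omega
  refine ⟨R, hRF, heq, fun J hRJ hJF => ?_⟩
  have hempty : ∀ y ∈ F \ R, P y = ∅ := fun y hy => by
    by_contra hPy
    have hpos := Finset.card_pos.2 (Finset.nonempty_iff_ne_empty.2 hPy)
    have hle := Finset.card_le_card (hPR y hy)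
    have hYe := Finset.card_erase_add_one hy
    have hRP : (R \ P y).card = R.card - (P y).card := Finset.card_sdiff_of_subset (hPR y hy)
    obtain ⟨D, hD, hDc⟩ := exists_card_add_card_biUnion_inter_eq P ((F \ R).erase y) (R \ P y)
      (r - s - 1 - (P y).card) (by omega) (by omega)
    have hDF := hD.trans (Finset.erase_subset _ _)
    refine hne (insert y D) (Finset.insert_subset hy hDF) (Finset.insert_nonempty y D) ?_
    have hU : (insert y D).biUnion P = P y ∪ D.biUnion P ∩ (R \ P y) := by
      rw [Finset.biUnion_insert, ← Finset.inter_sdiff_assoc, Finset.inter_eq_left.2 (hPD D hDF),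
        Finset.union_sdiff_self_eq_union]
    rw [Finset.card_insert_of_notMem fun h => Finset.notMem_erase _ _ (hD h), hU,
      Finset.card_union_of_disjoint (Finset.disjoint_sdiff.mono_right Finset.inter_subset_right)]
    omega
  have hsdiff : (F \ J).biUnion singleton ∈ G :=
    biUnion_mem_of_union_mem hG (Finset.sdiff_nonempty.2 hJF.2) fun y hy => by
      have hyR := Finset.sdiff_subset_sdiff subset_rfl hRJ hy
      simpa [hempty y hyR] using hP y hyR
  rw [Finset.biUnion_singleton_eq_self] at hsdiff
  simpa [Finset.sdiff_sdiff_eq_self hJF.1] using hsdiff.2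
end
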